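/- arXiv:0902.1470 — 2 statements merged into one kernel-verified Lean document; each statement's English description precedes it below -/
import Mathlib

section
/- Let n ≥ 2 and let p be the greatest proper divisor of n (that is, p = n/q where q is the smallest prime divisor of n). Then every semitransitive subsemigroup S of the singular part I_n \ S_n of the symmetric inverse semigroup satisfies |S| ≥ 2n − p + 1. -/
/-- `ISemi n` is the symmetric inverse semigroup `I_n`, realized as the set of all
partial injective maps (partial permutations) of the `n`-element set `Fin n`,
with composition given by `PEquiv.trans` (apply the left factor first, matching
the right-action convention `x φ`). -/
abbrev ISemi (n : ℕ) := PEquiv (Fin n) (Fin n)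

/-- `S` is a subsemigroup of `I_n`: a subset closed under composition. -/
def IsSubsemigroup {n : ℕ} (S : Set (ISemi n)) : Prop :=
  ∀ a ∈ S, ∀ b ∈ S, a.trans b ∈ S

/-- `φ` belongs to the singular part `I_n \ S_n`: its domain is a proper subset
of the underlying set, i.e. it is undefined somewhere. -/
def IsSingular {n : ℕ} (φ : ISemi n) : Prop :=
  ∃ x : Fin n, φ x = none

/-- `S` is semitransitive: for all `x, y` there is `φ ∈ S` with `φ x = y` or `φ y = x`. -/
def Semitransitive {n : ℕ} (S : Set (ISemi n)) : Prop :=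
  ∀ x y : Fin n, ∃ φ ∈ S, φ x = some y ∨ φ y = some x

/-- The semitransitivity preorder induced by `S`: `x ≥ y` iff some `φ ∈ S` maps `x` to `y`. -/
def STGe {n : ℕ} (S : Set (ISemi n)) (x y : Fin n) : Prop :=
  ∃ φ ∈ S, φ x = some y

/-- The transitivity block of `x`: the equivalence class of `x` under `x ≥ y ∧ y ≥ x`. -/
def STBlock {n : ℕ} (S : Set (ISemi n)) (x : Fin n) : Set (Fin n) :=
  {y | STGe S x y ∧ STGe S y x}

/-- `k`-th power of `φ` under composition (`pePow φ 0` is the identity). -/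
def pePow {n : ℕ} (φ : ISemi n) : ℕ → ISemi n
  | 0 => PEquiv.refl (Fin n)
  | k + 1 => (pePow φ k).trans φ

instance ISemi.finite (n : ℕ) : Finite (ISemi n) :=
  DFunLike.finite _

theorem ISemi.inj {n : ℕ} {f : ISemi n} {u u' v : Fin n} (h : f u = some v)
    (h' : f u' = some v) : u = u' :=
  PEquiv.inj f h h'

theorem ISemi.det {n : ℕ} {f : ISemi n} {u v v' : Fin n} (h : f u = some v)
    (h' : f u = some v') : v = v' :=
  Option.some.inj (h.symm.trans h')

theorem ISemi.trans_some {n : ℕ} {f g : ISemi n} {u v w : Fin n} (h : f u = some v)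
    (h' : g v = some w) : (f.trans g) u = some w :=
  (PEquiv.trans_eq_some f g u w).2 ⟨v, h, h'⟩

theorem ISemi.ext_some {n : ℕ} {f g : ISemi n} (h : ∀ u v, f u = some v ↔ g u = some v) :
    f = g :=
  PEquiv.ext fun u => Option.ext fun v => h u v

/-- A nonempty finite semigroup of partial injective maps contains an idempotent, which is a
partial identity. -/
theorem exists_partial_identity {n : ℕ} (T : Set (ISemi n)) (hne : T.Nonempty)
    (hT : IsSubsemigroup T) : ∃ f ∈ T, ∀ u v, f u = some v → u = v := by
  let _ : Semigroup T :=
    { mul := fun a b => ⟨a.1.trans b.1, hT _ a.2 _ b.2⟩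
      mul_assoc := fun a b c => Subtype.ext (PEquiv.trans_assoc a.1 b.1 c.1) }
  have : Nonempty T := hne.to_subtype
  let _ : TopologicalSpace T := ⊥
  have : DiscreteTopology T := ⟨rfl⟩
  obtain ⟨m, hm⟩ := exists_idempotent_of_compact_t2_of_continuous_mul_left
    (M := T) (fun r => continuous_of_discreteTopology)
  refine ⟨m.1, m.2, fun u v huv => ?_⟩
  have hmm : m.1.trans m.1 = m.1 := congrArg Subtype.val hm
  have h := huv
  rw [← hmm, PEquiv.trans_eq_some] at h
  obtain ⟨w, h1, h2⟩ := h
  obtain rfl := ISemi.det huv h1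
  exact ISemi.inj huv h2

section Core

variable {n : ℕ} {S : Set (ISemi n)}

theorem STGe.trans (hsub : IsSubsemigroup S) {x y z : Fin n} (h : STGe S x y)
    (h' : STGe S y z) : STGe S x z := by
  obtain ⟨f, hf, hxy⟩ := h
  obtain ⟨g, hg, hyz⟩ := h'
  exact ⟨f.trans g, hsub _ hf _ hg, ISemi.trans_some hxy hyz⟩

theorem STGe.total (hst : Semitransitive S) (x y : Fin n) : STGe S x y ∨ STGe S y x := by
  obtain ⟨f, hf, h | h⟩ := hst x y
  · exact .inl ⟨f, hf, h⟩
  · exact .inr ⟨f, hf, h⟩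

theorem STGe.refl (hst : Semitransitive S) (x : Fin n) : STGe S x x :=
  (STGe.total hst x x).elim id id

open scoped Classical in
/-- The points at which every element of `S` fixing `x` is defined; this is the domain of the
least idempotent of `S` fixing `x`. -/
noncomputable def core (S : Set (ISemi n)) (x : Fin n) : Finset (Fin n) :=
  Finset.univ.filter fun u => ∀ τ ∈ S, τ x = some x → ∃ v, τ u = some v

theorem mem_core {x u : Fin n} :
    u ∈ core S x ↔ ∀ τ ∈ S, τ x = some x → ∃ v, τ u = some v := by
  simp [core]

theorem self_mem_core (x : Fin n) : x ∈ core S x :=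
  mem_core.2 fun _ _ h => ⟨x, h⟩

theorem exists_core_idempotent (hsub : IsSubsemigroup S) (hst : Semitransitive S) (x : Fin n) :
    ∃ e ∈ S, ∀ u v, e u = some v ↔ u = v ∧ u ∈ core S x := by
  classical
  let T : Set (ISemi n) := {τ | τ ∈ S ∧ τ x = some x ∧ ∀ u v, τ u = some v → u = v}
  have key : ∀ τ ∈ S, τ x = some x → ∃ f ∈ T, ∀ u v, f u = some v → ∃ w, τ u = some w := by
    intro τ hτ hx
    obtain ⟨f, ⟨hfS, hfx, hfd⟩, hfi⟩ := exists_partial_identity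
      {σ | σ ∈ S ∧ σ x = some x ∧ ∀ u v, σ u = some v → ∃ w, τ u = some w}
      ⟨τ, hτ, hx, fun u v h => ⟨v, h⟩⟩ (by
        rintro a ⟨ha, hax, had⟩ b ⟨hb, hbx, -⟩
        refine ⟨hsub _ ha _ hb, ISemi.trans_some hax hbx, fun u v h => ?_⟩
        obtain ⟨w, hw, -⟩ := (PEquiv.trans_eq_some _ _ _ _).1 h
        exact had _ _ hw)
    exact ⟨f, ⟨hfS, hfx, hfi⟩, hfd⟩
  let D : ISemi n → Finset (Fin n) := fun f => Finset.univ.filter fun u => f u = some u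
  obtain ⟨τ₀, hτ₀, hx₀⟩ := STGe.refl hst x
  obtain ⟨f₀, hf₀, -⟩ := key τ₀ hτ₀ hx₀
  obtain ⟨e, ⟨heS, hex, hei⟩, hmin⟩ := Set.exists_min_image T (fun f => (D f).card)
    (Set.toFinite _) ⟨f₀, hf₀⟩
  refine ⟨e, heS, fun u v => ⟨fun h => ?_, ?_⟩⟩
  · obtain rfl := hei _ _ h
    refine ⟨rfl, mem_core.2 fun τ hτ hx => ?_⟩
    obtain ⟨f, ⟨hfS, hfx, hfi⟩, hfd⟩ := key τ hτ hx
    have hef : ∀ a b, (e.trans f) a = some b → a = b ∧ e a = some a ∧ f a = some a := by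
      intro a b hab
      obtain ⟨w, h1, h2⟩ := (PEquiv.trans_eq_some _ _ _ _).1 hab
      obtain rfl := hei _ _ h1
      obtain rfl := hfi _ _ h2
      exact ⟨rfl, h1, h2⟩
    have hle := hmin (e.trans f)
      ⟨hsub _ heS _ hfS, ISemi.trans_some hex hfx, fun a b hab => (hef a b hab).1⟩
    have hss : D (e.trans f) ⊆ D e := fun a ha => by
      simp only [D, Finset.mem_filter, Finset.mem_univ, true_and] at ha ⊢
      exact (hef _ _ ha).2.1
    have heq := Finset.eq_of_subset_of_card_le hss hle
    have hu : u ∈ D e := by simpa [D] using h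
    rw [← heq] at hu
    simp only [D, Finset.mem_filter, Finset.mem_univ, true_and] at hu
    exact hfd _ _ (hef _ _ hu).2.2
  · rintro ⟨rfl, hu⟩
    obtain ⟨w, hw⟩ := mem_core.1 hu e heS hex
    obtain rfl := hei _ _ hw
    exact hw

theorem core_subset (hsub : IsSubsemigroup S) (hst : Semitransitive S) {x y : Fin n}
    (h : y ∈ core S x) : core S y ⊆ core S x := by
  obtain ⟨e, heS, he⟩ := exists_core_idempotent hsub hst x
  intro u hu
  obtain ⟨v, hv⟩ := mem_core.1 hu e heS ((he y y).2 ⟨rfl, h⟩)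
  exact ((he _ _).1 hv).2

/-- `φ` maps `core S x` partially to `core S y` and vanishes elsewhere. -/
def IsCoreReduced (S : Set (ISemi n)) (x y : Fin n) (φ : ISemi n) : Prop :=
  φ ∈ S ∧ ∀ u v, φ u = some v → u ∈ core S x ∧ v ∈ core S y

theorem exists_reduced (hsub : IsSubsemigroup S) (hst : Semitransitive S) {x y : Fin n}
    (h : STGe S x y) : ∃ φ, IsCoreReduced S x y φ ∧ φ x = some y := by
  obtain ⟨φ, hφ, hxy⟩ := h
  obtain ⟨e, heS, he⟩ := exists_core_idempotent hsub hst x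
  obtain ⟨f, hfS, hf⟩ := exists_core_idempotent hsub hst y
  refine ⟨(e.trans φ).trans f, ⟨hsub _ (hsub _ heS _ hφ) _ hfS, fun u v huv => ?_⟩, ?_⟩
  · obtain ⟨w, h1, h2⟩ := (PEquiv.trans_eq_some _ _ _ _).1 huv
    obtain ⟨t, h3, h4⟩ := (PEquiv.trans_eq_some _ _ _ _).1 h1
    obtain ⟨rfl, h5⟩ := (hf _ _).1 h2
    exact ⟨((he _ _).1 h3).2, h5⟩
  · exact ISemi.trans_some (ISemi.trans_some ((he _ _).2 ⟨rfl, self_mem_core x⟩) hxy)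
      ((hf _ _).2 ⟨rfl, self_mem_core y⟩)

theorem IsCoreReduced.trans (hsub : IsSubsemigroup S) {x y z w : Fin n} {φ ψ : ISemi n}
    (hφ : IsCoreReduced S x y φ) (hψ : IsCoreReduced S z w ψ) :
    IsCoreReduced S x w (φ.trans ψ) := by
  refine ⟨hsub _ hφ.1 _ hψ.1, fun u v huv => ?_⟩
  obtain ⟨t, h1, h2⟩ := (PEquiv.trans_eq_some _ _ _ _).1 huv
  exact ⟨(hφ.2 _ _ h1).1, (hψ.2 _ _ h2).2⟩

theorem core_forward (hsub : IsSubsemigroup S) {τ : ISemi n} (hτ : τ ∈ S) {s t u : Fin n}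
    (hst' : τ s = some t) (hts : STGe S t s) (hu : u ∈ core S s) :
    ∃ v, τ u = some v ∧ STGe S v u := by
  obtain ⟨σ, hσ, hσt⟩ := hts
  obtain ⟨f, ⟨hfS, hfs, ρ, hρ, rfl⟩, hfi⟩ := exists_partial_identity
    {α | α ∈ S ∧ α s = some s ∧ ∃ ρ ∈ S, α = τ.trans ρ}
    ⟨τ.trans σ, hsub _ hτ _ hσ, ISemi.trans_some hst' hσt, σ, hσ, rfl⟩ (by
      rintro a ⟨ha, has, ρ, hρ, rfl⟩ b ⟨hb, hbs, -⟩
      exact ⟨hsub _ ha _ hb, ISemi.trans_some has hbs, ρ.trans b, hsub _ hρ _ hb,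
        PEquiv.trans_assoc _ _ _⟩)
  obtain ⟨v', hv'⟩ := mem_core.1 hu _ hfS hfs
  obtain rfl := hfi _ _ hv'
  obtain ⟨v, h1, h2⟩ := (PEquiv.trans_eq_some _ _ _ _).1 hv'
  exact ⟨v, h1, ρ, hρ, h2⟩

theorem core_backward (hsub : IsSubsemigroup S) {τ : ISemi n} (hτ : τ ∈ S) {s t v : Fin n}
    (hst' : τ s = some t) (hts : STGe S t s) (hv : v ∈ core S t) :
    ∃ u, τ u = some v ∧ STGe S v u := by
  obtain ⟨σ, hσ, hσt⟩ := hts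
  obtain ⟨f, ⟨hfS, hfs, ρ, hρ, rfl⟩, hfi⟩ := exists_partial_identity
    {α | α ∈ S ∧ α t = some t ∧ ∃ ρ ∈ S, α = ρ.trans τ}
    ⟨σ.trans τ, hsub _ hσ _ hτ, ISemi.trans_some hσt hst', σ, hσ, rfl⟩ (by
      rintro a ⟨ha, has, -⟩ b ⟨hb, hbs, ρ, hρ, rfl⟩
      exact ⟨hsub _ ha _ hb, ISemi.trans_some has hbs, a.trans ρ, hsub _ ha _ hρ,
        (PEquiv.trans_assoc _ _ _).symm⟩)
  obtain ⟨v', hv'⟩ := mem_core.1 hv _ hfS hfs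
  obtain rfl := hfi _ _ hv'
  obtain ⟨u, h1, h2⟩ := (PEquiv.trans_eq_some _ _ _ _).1 hv'
  exact ⟨u, h2, ρ, hρ, h1⟩

theorem core_card_le (hsub : IsSubsemigroup S) (hst : Semitransitive S) {u s : Fin n}
    (hus : STGe S u s) (hsu : STGe S s u) : (core S u).card ≤ (core S s).card := by
  obtain ⟨φ, hφ, hφu⟩ := exists_reduced hsub hst hus
  choose! g hg using fun a (ha : a ∈ core S u) => core_forward hsub hφ.1 hφu hsu ha
  exact Finset.card_le_card_of_injOn g (fun a ha => (hφ.2 _ _ (hg a ha).1).2)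
    fun a ha b hb hab => ISemi.inj (hg a ha).1 (hab ▸ (hg b hb).1)

theorem core_eq_of_mem (hsub : IsSubsemigroup S) (hst : Semitransitive S) {u s : Fin n}
    (hs : s ∈ core S u) (hus : STGe S u s) (hsu : STGe S s u) : core S s = core S u :=
  Finset.eq_of_subset_of_card_le (core_subset hsub hst hs) (core_card_le hsub hst hus hsu)

theorem bot_mem (hn : 0 < n) (hsub : IsSubsemigroup S) (hsing : ∀ φ ∈ S, IsSingular φ)
    (hst : Semitransitive S) : (⊥ : ISemi n) ∈ S := by
  classical
  by_contra hbot
  let T : Set (ISemi n) := {τ | τ ∈ S ∧ ∀ u v, τ u = some v → u = v}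
  let D : ISemi n → Finset (Fin n) := fun f => Finset.univ.filter fun u => f u = some u
  have memD : ∀ f u, u ∈ D f ↔ f u = some u := by simp [D]
  obtain ⟨f₀, hf₀, hf₀'⟩ := exists_partial_identity S
    (by obtain ⟨φ, hφ, -⟩ := hst ⟨0, hn⟩ ⟨0, hn⟩; exact ⟨φ, hφ⟩) hsub
  obtain ⟨e, ⟨heS, hei⟩, hmin⟩ := Set.exists_min_image T (fun f => (D f).card)
    (Set.toFinite _) ⟨f₀, hf₀, hf₀'⟩
  have key : ∀ φ ∈ S, ∀ z, e z = some z → ∃ y, φ z = some y ∧ e y = some y := by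
    intro φ hφ z hz
    obtain ⟨f, ⟨hfS, hfd⟩, hfi⟩ := exists_partial_identity
      {α | α ∈ S ∧ ∀ u v, α u = some v → e u = some u ∧ ∃ y, φ u = some y ∧ e y = some y}
      ⟨(e.trans φ).trans e, hsub _ (hsub _ heS _ hφ) _ heS, fun u v huv => by
        obtain ⟨w, h1, h2⟩ := (PEquiv.trans_eq_some _ _ _ _).1 huv
        obtain ⟨t, h3, h4⟩ := (PEquiv.trans_eq_some _ _ _ _).1 h1
        obtain rfl := hei _ _ h3
        obtain rfl := hei _ _ h2
        exact ⟨h3, _, h4, h2⟩⟩ (by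
        rintro a ⟨ha, had⟩ b ⟨hb, -⟩
        refine ⟨hsub _ ha _ hb, fun u v huv => ?_⟩
        obtain ⟨w, h1, h2⟩ := (PEquiv.trans_eq_some _ _ _ _).1 huv
        exact had _ _ h1)
    have hss : D f ⊆ D e := fun a ha => (memD _ _).2 (hfd _ _ ((memD _ _).1 ha)).1
    have heq := Finset.eq_of_subset_of_card_le hss (hmin f ⟨hfS, hfi⟩)
    have hzf : z ∈ D f := by rw [heq]; exact (memD _ _).2 hz
    exact (hfd _ _ ((memD _ _).1 hzf)).2
  obtain ⟨y, hy⟩ := hsing e heS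
  have hz : ∃ z, e z = some z := by
    by_contra hno
    push Not at hno
    apply hbot
    convert heS
    refine ISemi.ext_some fun u v => ⟨fun h => by simp at h, fun h => ?_⟩
    obtain rfl := hei _ _ h
    exact absurd h (hno _)
  obtain ⟨z, hz⟩ := hz
  obtain ⟨φ, hφ, h | h⟩ := hst z y
  · obtain ⟨y', h1, h2⟩ := key φ hφ z hz
    obtain rfl := ISemi.det h h1
    simp [hy] at h2
  · choose! g hg using key φ hφ
    have hinj : Set.InjOn g (D e) := fun a ha b hb hab => by
      have h1 := (hg a ((memD _ _).1 ha)).1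
      have h2 := (hg b ((memD _ _).1 hb)).1
      exact ISemi.inj h1 (hab ▸ h2)
    have hsurj := Finset.surjOn_of_injOn_of_card_le g
      (fun a ha => (memD _ _).2 (hg a ((memD _ _).1 ha)).2) hinj le_rfl
    obtain ⟨a, ha, rfl⟩ := hsurj ((memD _ _).2 hz)
    have ha' := (memD _ _).1 ha
    obtain rfl := ISemi.inj h (hg a ha').1
    simp [hy] at ha'

/-- If `u ≥ v`, some core-reduced element maps `u` to `v` and maps points below `u` to points
below `v`. -/
theorem exists_reduced_low (hsub : IsSubsemigroup S) (hst : Semitransitive S) {u v : Fin n}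
    (huv : STGe S u v) :
    ∃ τ, IsCoreReduced S u v τ ∧ τ u = some v ∧
      ∀ s t, STGe S u s → τ s = some t → STGe S v t := by
  classical
  induction hk : (Finset.univ.filter fun w => STGe S u w ∧ STGe S w v).card
    using Nat.strong_induction_on generalizing u v with
  | _ k ih =>
  by_cases hvu : STGe S v u
  · obtain ⟨τ, hτ, h⟩ := exists_reduced hsub hst huv
    exact ⟨τ, hτ, h, fun s t hus hst' => (hvu.trans hsub hus).trans hsub ⟨τ, hτ.1, hst'⟩⟩
  obtain ⟨τ, hτ, h⟩ := exists_reduced hsub hst huv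
  by_cases hgood : ∀ s t, STGe S u s → τ s = some t → STGe S v t
  · exact ⟨τ, hτ, h, hgood⟩
  push Not at hgood
  obtain ⟨s, w, hus, hsw, hvw⟩ := hgood
  have hwv : STGe S w v := (STGe.total hst v w).resolve_left hvw
  have hsw' : STGe S s w := ⟨τ, hτ.1, hsw⟩
  have huw : STGe S u w := hus.trans hsub hsw'
  by_cases hwu : STGe S w u
  · have hsu : STGe S s u := hsw'.trans hsub hwu
    have hcore := core_eq_of_mem hsub hst (hτ.2 _ _ hsw).1 hus hsu
    obtain ⟨v', h1, h2⟩ := core_forward hsub hτ.1 hsw (hwu.trans hsub hus)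
      (hcore ▸ self_mem_core u)
    obtain rfl := ISemi.det h h1
    exact absurd h2 hvu
  · obtain ⟨σ, hσ, hσu, hσl⟩ := ih _ (hk ▸ Finset.card_lt_card (by
      refine ⟨fun a => ?_, fun hsub' => ?_⟩
      · simp only [Finset.mem_filter, Finset.mem_univ, true_and]
        exact fun ⟨h1, h2⟩ => ⟨h1, h2.trans hsub hwv⟩
      · have := hsub' (x := v) (by simp [huv, STGe.refl hst])
        simp only [Finset.mem_filter, Finset.mem_univ, true_and] at this
        exact hvw this.2)) huw rfl
    obtain ⟨ρ, hρ, hρu, hρl⟩ := ih _ (hk ▸ Finset.card_lt_card (by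
      refine ⟨fun a => ?_, fun hsub' => ?_⟩
      · simp only [Finset.mem_filter, Finset.mem_univ, true_and]
        exact fun ⟨h1, h2⟩ => ⟨huw.trans hsub h1, h2⟩
      · have := hsub' (x := u) (by simp [huv, STGe.refl hst])
        simp only [Finset.mem_filter, Finset.mem_univ, true_and] at this
        exact hwu this.1)) hwv rfl
    refine ⟨σ.trans ρ, hσ.trans hsub hρ, ISemi.trans_some hσu hρu, fun a b ha hab => ?_⟩
    obtain ⟨c, h1, h2⟩ := (PEquiv.trans_eq_some _ _ _ _).1 hab
    exact hρl _ _ (hσl _ _ ha h1) h2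

/-- If `u ≥ v`, some core-reduced element maps `u` to `v` and only maps points above `u` to points
above `v`. -/
theorem exists_reduced_high (hsub : IsSubsemigroup S) (hst : Semitransitive S) {u v : Fin n}
    (huv : STGe S u v) :
    ∃ τ, IsCoreReduced S u v τ ∧ τ u = some v ∧
      ∀ s t, τ s = some t → STGe S t v → STGe S s u := by
  classical
  induction hk : (Finset.univ.filter fun w => STGe S u w ∧ STGe S w v).card
    using Nat.strong_induction_on generalizing u v with
  | _ k ih =>
  by_cases hvu : STGe S v u
  · obtain ⟨τ, hτ, h⟩ := exists_reduced hsub hst huv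
    exact ⟨τ, hτ, h, fun s t hst' htv =>
      (STGe.trans hsub ⟨τ, hτ.1, hst'⟩ htv).trans hsub hvu⟩
  obtain ⟨τ, hτ, h⟩ := exists_reduced hsub hst huv
  by_cases hgood : ∀ s t, τ s = some t → STGe S t v → STGe S s u
  · exact ⟨τ, hτ, h, hgood⟩
  push Not at hgood
  obtain ⟨w, t, hwt, htv, hwu⟩ := hgood
  have huw : STGe S u w := (STGe.total hst w u).resolve_left hwu
  have hwt' : STGe S w t := ⟨τ, hτ.1, hwt⟩
  have hwv : STGe S w v := hwt'.trans hsub htv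
  by_cases hvw : STGe S v w
  · have hvt : STGe S v t := hvw.trans hsub hwt'
    have hcore := core_eq_of_mem hsub hst (hτ.2 _ _ hwt).2 hvt htv
    obtain ⟨u', h1, h2⟩ := core_backward hsub hτ.1 hwt (htv.trans hsub hvw)
      (hcore ▸ self_mem_core v)
    obtain rfl := ISemi.inj h h1
    exact absurd h2 hvu
  · obtain ⟨σ, hσ, hσu, hσl⟩ := ih _ (hk ▸ Finset.card_lt_card (by
      refine ⟨fun a => ?_, fun hsub' => ?_⟩
      · simp only [Finset.mem_filter, Finset.mem_univ, true_and]
        exact fun ⟨h1, h2⟩ => ⟨h1, h2.trans hsub hwv⟩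
      · have := hsub' (x := v) (by simp [huv, STGe.refl hst])
        simp only [Finset.mem_filter, Finset.mem_univ, true_and] at this
        exact hvw this.2)) huw rfl
    obtain ⟨ρ, hρ, hρu, hρl⟩ := ih _ (hk ▸ Finset.card_lt_card (by
      refine ⟨fun a => ?_, fun hsub' => ?_⟩
      · simp only [Finset.mem_filter, Finset.mem_univ, true_and]
        exact fun ⟨h1, h2⟩ => ⟨huw.trans hsub h1, h2⟩
      · have := hsub' (x := u) (by simp [huv, STGe.refl hst])
        simp only [Finset.mem_filter, Finset.mem_univ, true_and] at this
        exact hwu this.1)) hwv rfl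
    refine ⟨σ.trans ρ, hσ.trans hsub hρ, ISemi.trans_some hσu hρu, fun a b hab hb => ?_⟩
    obtain ⟨c, h1, h2⟩ := (PEquiv.trans_eq_some _ _ _ _).1 hab
    exact hσl _ _ h1 (hρl _ _ h2 hb)

end Core

section Rectangle

variable {n : ℕ} {A B : Finset (Fin n)} {Q : Finset (ISemi n)}

/-- `Q` is stable under precomposition with partial injective maps acting on `A` as a
transitive family, and precomposition with them is cancellative on `Q`. -/
def LeftHomogeneous (A : Finset (Fin n)) (Q : Finset (ISemi n)) : Prop :=
  ∀ x ∈ A, ∀ x' ∈ A, ∃ h : ISemi n, h x' = some x ∧ (∀ u ∈ A, ∃ u' ∈ A, h u' = some u) ∧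
    (∀ ψ ∈ Q, h.trans ψ ∈ Q) ∧ ∀ ψ ∈ Q, ∀ ψ' ∈ Q, h.trans ψ = h.trans ψ' → ψ = ψ'

/-- The mirror image of `LeftHomogeneous`, for postcomposition. -/
def RightHomogeneous (B : Finset (Fin n)) (Q : Finset (ISemi n)) : Prop :=
  ∀ y ∈ B, ∀ y' ∈ B, ∃ h : ISemi n, h y = some y' ∧ (∀ u ∈ B, ∃ u' ∈ B, h u = some u') ∧
    (∀ ψ ∈ Q, ψ.trans h ∈ Q) ∧ ∀ ψ ∈ Q, ∀ ψ' ∈ Q, ψ.trans h = ψ'.trans h → ψ = ψ'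

theorem LeftHomogeneous.card_dvd (hhit : ∀ ψ ∈ Q, ∃ x ∈ A, ∃ y ∈ B, ψ x = some y)
    (hex : ∀ x ∈ A, ∀ y ∈ B, ∃ ψ ∈ Q, ψ x = some y) (hL : LeftHomogeneous A Q)
    (huniq : ∀ x ∈ A, ∀ y ∈ B, ∀ ψ ∈ Q, ∀ ψ' ∈ Q, ψ x = some y → ψ' x = some y → ψ = ψ') :
    A.card ∣ Q.card := by
  classical
  let F : Fin n → Finset (ISemi n) := fun y => Q.filter fun ψ => ∃ x ∈ A, ψ x = some y
  have memF : ∀ y ψ, ψ ∈ F y ↔ ψ ∈ Q ∧ ∃ x ∈ A, ψ x = some y := by simp [F]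
  have hsubset : ∀ y ∈ B, ∀ y', ∀ ψ, ψ ∈ F y → ψ ∈ F y' → F y ⊆ F y' := by
    intro y hy y' ψ hψ hψ' ψ₂ hψ₂
    obtain ⟨hψQ, x, hx, hxy⟩ := (memF _ _).1 hψ
    obtain ⟨-, u, hu, huy⟩ := (memF _ _).1 hψ'
    obtain ⟨hψ₂Q, x', hx', hxy'⟩ := (memF _ _).1 hψ₂
    obtain ⟨h, hh, hA, hQ, -⟩ := hL x hx x' hx'
    obtain ⟨u', hu', hu'u⟩ := hA u hu
    have := huniq x' hx' y hy _ (hQ ψ hψQ) ψ₂ hψ₂Q (ISemi.trans_some hh hxy) hxy'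
    exact (memF _ _).2 ⟨hψ₂Q, u', hu', this ▸ ISemi.trans_some hu'u huy⟩
  have hcard : ∀ y ∈ B, (F y).card = A.card := by
    intro y hy
    have : Nonempty (Fin n) := ⟨y⟩
    choose! g hgA hg using fun ψ (hψ : ψ ∈ F y) => ((memF _ _).1 hψ).2
    refine Finset.card_nbij g hgA (fun ψ hψ ψ' hψ' h => ?_) fun x hx => ?_
    · exact huniq _ (hgA _ hψ) y hy _ ((memF _ _).1 hψ).1 _ ((memF _ _).1 hψ').1 (hg _ hψ)
        (h ▸ hg _ hψ')
    · obtain ⟨ψ, hψ, hxy⟩ := hex x hx y hy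
      have hm : ψ ∈ F y := (memF _ _).2 ⟨hψ, x, hx, hxy⟩
      exact ⟨ψ, hm, ISemi.inj (hg _ hm) hxy⟩
  have hQ : Q = (B.image F).biUnion id := by
    ext ψ
    simp only [Finset.mem_biUnion, Finset.mem_image, id]
    constructor
    · intro hψ
      obtain ⟨x, hx, y, hy, hxy⟩ := hhit ψ hψ
      exact ⟨F y, ⟨y, hy, rfl⟩, (memF _ _).2 ⟨hψ, x, hx, hxy⟩⟩
    · rintro ⟨_, ⟨y, hy, rfl⟩, hψ⟩
      exact ((memF _ _).1 hψ).1
  rw [hQ, Finset.card_biUnion]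
  · refine Finset.dvd_sum fun s hs => ?_
    obtain ⟨y, hy, rfl⟩ := Finset.mem_image.1 hs
    exact (hcard y hy).symm.dvd
  · intro s hs t ht hst
    obtain ⟨y, hy, rfl⟩ := Finset.mem_image.1 hs
    obtain ⟨y', hy', rfl⟩ := Finset.mem_image.1 ht
    refine Finset.disjoint_left.2 fun ψ h1 h2 => hst ?_
    exact Finset.Subset.antisymm (hsubset y hy y' ψ h1 h2) (hsubset y' hy' y ψ h2 h1)

theorem LeftHomogeneous.two_mul_card_le (hL : LeftHomogeneous A Q) {x y : Fin n} (hx : x ∈ A)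
    {ψ₁ ψ₂ : ISemi n} (h₁ : ψ₁ ∈ Q) (h₂ : ψ₂ ∈ Q) (hne : ψ₁ ≠ ψ₂) (hxy₁ : ψ₁ x = some y)
    (hxy₂ : ψ₂ x = some y) : 2 * A.card ≤ Q.card := by
  classical
  choose! h hh _ hQ hinj using fun x' (hx' : x' ∈ A) => hL x hx x' hx'
  have hd : Disjoint (A.image fun a => (h a).trans ψ₁) (A.image fun a => (h a).trans ψ₂) := by
    refine Finset.disjoint_left.2 fun ψ hψ hψ' => ?_
    obtain ⟨a, ha, rfl⟩ := Finset.mem_image.1 hψ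
    obtain ⟨b, hb, hab⟩ := Finset.mem_image.1 hψ'
    have h1 := ISemi.trans_some (hh a ha) hxy₁
    have h2 := ISemi.trans_some (hh b hb) hxy₂
    obtain rfl := ISemi.inj h1 (hab ▸ h2)
    exact hne (hinj a ha _ h₁ _ h₂ hab.symm)
  have hc : ∀ ψ : ISemi n, ψ x = some y → (A.image fun a => (h a).trans ψ).card = A.card :=
    fun ψ hψ => Finset.card_image_of_injOn fun a ha b hb (hab : (h a).trans ψ = (h b).trans ψ) =>
      ISemi.inj (ISemi.trans_some (hh a ha) hψ) (hab ▸ ISemi.trans_some (hh b hb) hψ)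
  rw [two_mul]
  nth_rw 1 [← hc ψ₁ hxy₁]
  rw [← hc ψ₂ hxy₂, ← Finset.card_union_of_disjoint hd]
  refine Finset.card_le_card (Finset.union_subset ?_ ?_) <;> intro ψ hψ <;>
    obtain ⟨a, ha, rfl⟩ := Finset.mem_image.1 hψ
  exacts [hQ a ha _ h₁, hQ a ha _ h₂]

/-- Either the cardinality of a homogeneous set of maps is a multiple of both sides of the
rectangle it covers, or it is at least twice each of them. -/
theorem card_dvd_or_two_mul_le (hhit : ∀ ψ ∈ Q, ∃ x ∈ A, ∃ y ∈ B, ψ x = some y)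
    (hex : ∀ x ∈ A, ∀ y ∈ B, ∃ ψ ∈ Q, ψ x = some y) (hL : LeftHomogeneous A Q)
    (hR : RightHomogeneous B Q) :
    (A.card ∣ Q.card ∧ B.card ∣ Q.card) ∨ (2 * A.card ≤ Q.card ∧ 2 * B.card ≤ Q.card) := by
  classical
  have hsinj : Function.Injective (PEquiv.symm : ISemi n → ISemi n) := PEquiv.symm_injective
  let Q' : Finset (ISemi n) := Q.image PEquiv.symm
  have hcard : Q'.card = Q.card := Finset.card_image_of_injective _ hsinj
  have hL' : LeftHomogeneous B Q' := by
    intro x hx x' hx'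
    obtain ⟨h, h1, h2, h3, h4⟩ := hR x hx x' hx'
    refine ⟨h.symm, (PEquiv.eq_some_iff h).2 h1, fun u hu => ?_, fun ψ hψ => ?_,
      fun ψ hψ ψ' hψ' he => ?_⟩
    · obtain ⟨u', hu', h5⟩ := h2 u hu
      exact ⟨u', hu', (PEquiv.eq_some_iff h).2 h5⟩
    · obtain ⟨φ, hφ, rfl⟩ := Finset.mem_image.1 hψ
      exact Finset.mem_image.2 ⟨_, h3 φ hφ, PEquiv.symm_trans_rev _ _⟩
    · obtain ⟨φ, hφ, rfl⟩ := Finset.mem_image.1 hψ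
      obtain ⟨φ', hφ', rfl⟩ := Finset.mem_image.1 hψ'
      rw [← PEquiv.symm_trans_rev, ← PEquiv.symm_trans_rev] at he
      rw [h4 φ hφ φ' hφ' (hsinj he)]
  by_cases huniq : ∀ x ∈ A, ∀ y ∈ B, ∀ ψ ∈ Q, ∀ ψ' ∈ Q, ψ x = some y → ψ' x = some y → ψ = ψ'
  · refine .inl ⟨hL.card_dvd hhit hex huniq, hcard ▸ hL'.card_dvd (B := A) ?_ ?_ ?_⟩
    · intro ψ hψ
      obtain ⟨φ, hφ, rfl⟩ := Finset.mem_image.1 hψ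
      obtain ⟨x, hx, y, hy, hxy⟩ := hhit φ hφ
      exact ⟨y, hy, x, hx, (PEquiv.eq_some_iff φ).2 hxy⟩
    · intro y hy x hx
      obtain ⟨ψ, hψ, hxy⟩ := hex x hx y hy
      exact ⟨ψ.symm, Finset.mem_image_of_mem _ hψ, (PEquiv.eq_some_iff ψ).2 hxy⟩
    · intro y hy x hx ψ hψ ψ' hψ' h1 h2
      obtain ⟨φ, hφ, rfl⟩ := Finset.mem_image.1 hψ
      obtain ⟨φ', hφ', rfl⟩ := Finset.mem_image.1 hψ'
      rw [huniq x hx y hy φ hφ φ' hφ' ((PEquiv.eq_some_iff φ).1 h1)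
        ((PEquiv.eq_some_iff φ').1 h2)]
  · push Not at huniq
    obtain ⟨x, hx, y, hy, ψ, hψ, ψ', hψ', h1, h2, hne⟩ := huniq
    exact .inr ⟨hL.two_mul_card_le hx hψ hψ' hne h1 h2,
      hcard ▸ hL'.two_mul_card_le hy (Finset.mem_image_of_mem _ hψ)
        (Finset.mem_image_of_mem _ hψ') (hsinj.ne hne) ((PEquiv.eq_some_iff ψ).2 h1)
        ((PEquiv.eq_some_iff ψ').2 h2)⟩

end Rectangle

section HitSet

variable {n : ℕ} {S : Set (ISemi n)}

open scoped Classical in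
/-- The transitivity block of `x` as a finset. -/
noncomputable def block (S : Set (ISemi n)) (x : Fin n) : Finset (Fin n) :=
  Finset.univ.filter fun y => STGe S x y ∧ STGe S y x

theorem mem_block {x y : Fin n} : y ∈ block S x ↔ STGe S x y ∧ STGe S y x := by
  simp [block]

theorem self_mem_block (hst : Semitransitive S) (x : Fin n) : x ∈ block S x :=
  mem_block.2 ⟨STGe.refl hst x, STGe.refl hst x⟩

/-- The core-reduced elements that satisfy `P` and map some point of the block of `u` to a point
of the block of `v`. -/
noncomputable def hitSet (S : Set (ISemi n)) (P : ISemi n → Prop) (u v : Fin n) :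
    Finset (ISemi n) :=
  (Set.toFinite {τ | IsCoreReduced S u v τ ∧
    (∃ s ∈ block S u, ∃ t ∈ block S v, τ s = some t) ∧ P τ}).toFinset

theorem mem_hitSet {P : ISemi n → Prop} {u v : Fin n} {τ : ISemi n} :
    τ ∈ hitSet S P u v ↔ IsCoreReduced S u v τ ∧
      (∃ s ∈ block S u, ∃ t ∈ block S v, τ s = some t) ∧ P τ := by
  simp [hitSet]

theorem IsCoreReduced.congr {x y z w : Fin n} {φ : ISemi n} (h : IsCoreReduced S x y φ)
    (h₁ : core S x = core S z) (h₂ : core S y = core S w) : IsCoreReduced S z w φ :=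
  ⟨h.1, fun u v huv => ⟨h₁ ▸ (h.2 u v huv).1, h₂ ▸ (h.2 u v huv).2⟩⟩

theorem leftHomogeneous_hitSet (hsub : IsSubsemigroup S) (hst : Semitransitive S)
    (hcore : ∀ x y, STGe S x y → STGe S y x → core S x = core S y) {P : ISemi n → Prop}
    {u v : Fin n} (hP : ∀ h ∈ S, ∀ ψ, P ψ → P (h.trans ψ)) :
    LeftHomogeneous (block S u) (hitSet S P u v) := by
  intro x hx x' hx'
  rw [mem_block] at hx hx'
  have hux := hcore u x hx.1 hx.2
  have hux' := hcore u x' hx'.1 hx'.2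
  obtain ⟨h, hh, hxx⟩ := exists_reduced hsub hst (hx'.2.trans hsub hx.1)
  have hback : ∀ a ∈ core S u, ∃ b, h b = some a ∧ STGe S a b := fun a ha =>
    core_backward hsub hh.1 hxx (hx.2.trans hsub hx'.1) (hux ▸ ha)
  have hA : ∀ a ∈ block S u, ∃ b ∈ block S u, h b = some a := by
    intro a ha
    rw [mem_block] at ha
    obtain ⟨b, hb, hab⟩ := hback a (hcore u a ha.1 ha.2 ▸ self_mem_core a)
    exact ⟨b, mem_block.2 ⟨ha.1.trans hsub hab, STGe.trans hsub ⟨h, hh.1, hb⟩ ha.2⟩, hb⟩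
  refine ⟨h, hxx, hA, fun ψ hψ => ?_, ?_⟩
  · obtain ⟨h1, ⟨s, hs, t, ht, hψs⟩, h2⟩ := mem_hitSet.1 hψ
    obtain ⟨b, hb, hbs⟩ := hA s hs
    exact mem_hitSet.2 ⟨(hh.trans hsub h1).congr hux'.symm rfl,
      ⟨b, hb, t, ht, ISemi.trans_some hbs hψs⟩, hP _ hh.1 _ h2⟩
  · have key : ∀ ψ ∈ hitSet S P u v, ∀ ψ' : ISemi n, h.trans ψ = h.trans ψ' →
        ∀ s t, ψ s = some t → ψ' s = some t := by
      intro ψ hψ ψ' he s t hs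
      obtain ⟨b, hb, -⟩ := hback s ((mem_hitSet.1 hψ).1.2 _ _ hs).1
      have := ISemi.trans_some hb hs
      rw [he, PEquiv.trans_eq_some] at this
      obtain ⟨s', h1, h2⟩ := this
      rwa [ISemi.det hb h1]
    exact fun ψ hψ ψ' hψ' he => ISemi.ext_some fun s t =>
      ⟨key ψ hψ ψ' he s t, key ψ' hψ' ψ he.symm s t⟩

theorem rightHomogeneous_hitSet (hsub : IsSubsemigroup S) (hst : Semitransitive S)
    (hcore : ∀ x y, STGe S x y → STGe S y x → core S x = core S y) {P : ISemi n → Prop}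
    {u v : Fin n} (hP : ∀ h ∈ S, ∀ ψ, P ψ → P (ψ.trans h)) :
    RightHomogeneous (block S v) (hitSet S P u v) := by
  intro y hy y' hy'
  rw [mem_block] at hy hy'
  have hvy := hcore v y hy.1 hy.2
  have hvy' := hcore v y' hy'.1 hy'.2
  obtain ⟨h, hh, hyy⟩ := exists_reduced hsub hst (hy.2.trans hsub hy'.1)
  have hforw : ∀ a ∈ core S v, ∃ b, h a = some b ∧ STGe S b a := fun a ha =>
    core_forward hsub hh.1 hyy (hy'.2.trans hsub hy.1) (hvy ▸ ha)
  have hB : ∀ a ∈ block S v, ∃ b ∈ block S v, h a = some b := by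
    intro a ha
    rw [mem_block] at ha
    obtain ⟨b, hb, hab⟩ := hforw a (hcore v a ha.1 ha.2 ▸ self_mem_core a)
    exact ⟨b, mem_block.2 ⟨ha.1.trans hsub ⟨h, hh.1, hb⟩, hab.trans hsub ha.2⟩, hb⟩
  refine ⟨h, hyy, hB, fun ψ hψ => ?_, ?_⟩
  · obtain ⟨h1, ⟨s, hs, t, ht, hψs⟩, h2⟩ := mem_hitSet.1 hψ
    obtain ⟨b, hb, hbs⟩ := hB t ht
    exact mem_hitSet.2 ⟨(h1.trans hsub hh).congr rfl hvy'.symm,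
      ⟨s, hs, b, hb, ISemi.trans_some hψs hbs⟩, hP _ hh.1 _ h2⟩
  · have key : ∀ ψ ∈ hitSet S P u v, ∀ ψ' : ISemi n, ψ.trans h = ψ'.trans h →
        ∀ s t, ψ s = some t → ψ' s = some t := by
      intro ψ hψ ψ' he s t hs
      obtain ⟨b, hb, -⟩ := hforw t ((mem_hitSet.1 hψ).1.2 _ _ hs).2
      have := ISemi.trans_some hs hb
      rw [he, PEquiv.trans_eq_some] at this
      obtain ⟨t', h1, h2⟩ := this
      rwa [ISemi.inj hb h2]
    exact fun ψ hψ ψ' hψ' he => ISemi.ext_some fun s t =>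
      ⟨key ψ hψ ψ' he s t, key ψ' hψ' ψ he.symm s t⟩

theorem hitSet_card (hsub : IsSubsemigroup S) (hst : Semitransitive S)
    (hcore : ∀ x y, STGe S x y → STGe S y x → core S x = core S y) {P : ISemi n → Prop}
    {u v : Fin n} (hPl : ∀ h ∈ S, ∀ ψ, P ψ → P (h.trans ψ))
    (hPr : ∀ h ∈ S, ∀ ψ, P ψ → P (ψ.trans h)) (hne : (hitSet S P u v).Nonempty) :
    ((block S u).card ∣ (hitSet S P u v).card ∧ (block S v).card ∣ (hitSet S P u v).card) ∨
      (2 * (block S u).card ≤ (hitSet S P u v).card ∧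
        2 * (block S v).card ≤ (hitSet S P u v).card) := by
  have hL := leftHomogeneous_hitSet hsub hst hcore (P := P) (u := u) (v := v) hPl
  have hR := rightHomogeneous_hitSet hsub hst hcore (P := P) (u := u) (v := v) hPr
  obtain ⟨ψ, hψ⟩ := hne
  refine card_dvd_or_two_mul_le (fun τ hτ => (mem_hitSet.1 hτ).2.1) (fun x hx y hy => ?_) hL hR
  obtain ⟨-, ⟨s, hs, t, ht, hψs⟩, -⟩ := mem_hitSet.1 hψ
  obtain ⟨h, hxs, -, hh, -⟩ := hL s hs x hx
  obtain ⟨k, hty, -, hk, -⟩ := hR t ht y hy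
  exact ⟨_, hk _ (hh _ hψ), ISemi.trans_some (ISemi.trans_some hxs hψs) hty⟩

end HitSet

section Arithmetic

/-- The possible cardinalities of a homogeneous set of maps between blocks of sizes `x`, `y`. -/
def RectCard (x y q : ℕ) : Prop :=
  0 < q ∧ ((x ∣ q ∧ y ∣ q) ∨ (2 * x ≤ q ∧ 2 * y ≤ q))

theorem RectCard.le_left {x y q : ℕ} (h : RectCard x y q) : x ≤ q := by
  obtain ⟨h0, ⟨h1, -⟩ | ⟨h1, -⟩⟩ := h
  · exact Nat.le_of_dvd h0 h1
  · omega

theorem RectCard.le_right {x y q : ℕ} (h : RectCard x y q) : y ≤ q := by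
  obtain ⟨h0, ⟨-, h1⟩ | ⟨-, h1⟩⟩ := h
  · exact Nat.le_of_dvd h0 h1
  · omega

theorem RectCard.symm {x y q : ℕ} (h : RectCard x y q) : RectCard y x q :=
  ⟨h.1, h.2.imp And.symm And.symm⟩

theorem RectCard.eq_of_lt {x y q : ℕ} (h : RectCard x y q) (hxy : x ≤ y) (hq : q < x + y) :
    q = y ∧ x ∣ y := by
  obtain ⟨h0, ⟨h1, k, rfl⟩ | h1⟩ := h
  · have : k = 1 := by
      obtain _ | _ | k := k
      · simp at h0
      · rfl
      · nlinarith
    subst this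
    exact ⟨by simp, by simpa using h1⟩
  · omega

theorem RectCard.two_mul_add_le {x a b f g : ℕ} (hf : RectCard x a f) (hg : RectCard x b g)
    (hab : a ≤ b) (hx : ¬ a ∣ x) : 2 * x + a ≤ f + g := by
  have h1 := hf.le_left
  have h2 := hg.le_left
  have h3 := hg.le_right
  by_cases h : x + a ≤ f
  · omega
  obtain hxa | hxa := le_total x a
  · obtain ⟨rfl, k, rfl⟩ := hf.eq_of_lt hxa (by omega)
    obtain _ | _ | k := k
    · simp at hx
      omega
    · simp at hx
    · nlinarith
  · exact absurd (hf.symm.eq_of_lt hxa (by omega)).2 hx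

theorem rectCard_sum {ι : Type*} [DecidableEq ι] {R : Finset ι} {c F G : ι → ℕ} {A B : ι}
    (hA : A ∈ R) (hB : B ∈ R) (hAB : A ≠ B) (hc : ∀ r ∈ R, 0 < c r)
    (hF : ∀ r ∈ R, RectCard (c r) (c A) (F r)) (hG : ∀ r ∈ R, RectCard (c r) (c B) (G r)) {p : ℕ}
    (hp : ∀ d, d ∣ ∑ r ∈ R, c r → d < ∑ r ∈ R, c r → d ≤ p) :
    2 * ∑ r ∈ R, c r ≤ p + (∑ r ∈ R.erase B, F r + ∑ r ∈ R, G r) := by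
  have hA' : A ∈ R.erase B := Finset.mem_erase.2 ⟨hAB, hA⟩
  set T := (R.erase B).erase A with hT
  have hTR : ∀ r ∈ T, r ∈ R := fun r hr => (Finset.mem_erase.1 (Finset.mem_erase.1 hr).2).2
  have hdec : ∀ f : ι → ℕ, ∑ r ∈ R, f r = f B + (f A + ∑ r ∈ T, f r) := fun f => by
    rw [Finset.add_sum_erase _ _ hA', Finset.add_sum_erase _ _ hB]
  have hdecF : ∑ r ∈ R.erase B, F r = F A + ∑ r ∈ T, F r := by
    rw [Finset.add_sum_erase _ _ hA']
  have hle : ∀ r ∈ T, 2 * c r ≤ F r + G r := fun r hr => by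
    have h1 := (hF r (hTR r hr)).le_left
    have h2 := (hG r (hTR r hr)).le_left
    omega
  have hsum : 2 * ∑ r ∈ T, c r ≤ ∑ r ∈ T, F r + ∑ r ∈ T, G r := by
    rw [Finset.mul_sum, ← Finset.sum_add_distrib]
    exact Finset.sum_le_sum hle
  have hFA := (hF A hA).le_left
  have hGB := (hG B hB).le_left
  have hGA := hG A hA
  have hcA := hc A hA
  have hcB := hc B hB
  have hfinish : ∀ d, d ∣ c A → d ∣ c B → d ≤ c A → c A + c B ≤ G A + d →
      (∀ r ∈ T, ¬ d ∣ c r → 2 * c r + d ≤ F r + G r) →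
      2 * ∑ r ∈ R, c r ≤ p + (∑ r ∈ R.erase B, F r + ∑ r ∈ R, G r) := by
    intro d hdA hdB hdle hd hr
    by_cases hall : ∀ r ∈ T, d ∣ c r
    · have := hp d (by
        rw [hdec]
        exact dvd_add hdB (dvd_add hdA (Finset.dvd_sum hall))) (by
        rw [hdec]
        omega)
      rw [hdec c, hdecF, hdec G]
      omega
    · push Not at hall
      obtain ⟨r, hrT, hdr⟩ := hall
      have h1 := hr r hrT hdr
      have h2 : 2 * ∑ r ∈ T, c r + d ≤ ∑ r ∈ T, F r + ∑ r ∈ T, G r := by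
        rw [Finset.mul_sum, ← Finset.sum_add_distrib, ← Finset.add_sum_erase _ _ hrT,
          ← Finset.add_sum_erase _ (fun r => F r + G r) hrT]
        have := Finset.sum_le_sum (s := T.erase r) fun i hi => hle i (Finset.mem_of_mem_erase hi)
        omega
      rw [hdec c, hdecF, hdec G]
      omega
  by_cases hW : c A + c B ≤ G A
  · rw [hdec c, hdecF, hdec G]
    omega
  obtain h | h := le_total (c A) (c B)
  · obtain ⟨h1, h2⟩ := hGA.eq_of_lt h (by omega)
    exact hfinish (c A) dvd_rfl h2 le_rfl (by omega)
      fun r hr hdr => (hF r (hTR r hr)).two_mul_add_le (hG r (hTR r hr)) h hdr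
  · obtain ⟨h1, h2⟩ := hGA.symm.eq_of_lt h (by omega)
    refine hfinish (c B) h2 dvd_rfl h (by omega) fun r hr hdr => ?_
    have := (hG r (hTR r hr)).two_mul_add_le (hF r (hTR r hr)) h hdr
    omega

end Arithmetic

section Count

variable {n : ℕ} {S : Set (ISemi n)}

theorem block_eq_of_mem (hsub : IsSubsemigroup S) {x y : Fin n} (h : y ∈ block S x) :
    block S y = block S x := by
  rw [mem_block] at h
  ext z
  simp only [mem_block]
  exact ⟨fun hz => ⟨h.1.trans hsub hz.1, hz.2.trans hsub h.2⟩,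
    fun hz => ⟨h.2.trans hsub hz.1, hz.2.trans hsub h.1⟩⟩

theorem exists_block_transversal (hsub : IsSubsemigroup S) (hst : Semitransitive S)
    {x₀ y₀ : Fin n} (h : y₀ ∉ block S x₀) :
    ∃ R : Finset (Fin n), x₀ ∈ R ∧ y₀ ∈ R ∧
      (∀ r ∈ R, ∀ r' ∈ R, r' ∈ block S r → r = r') ∧ ∑ r ∈ R, (block S r).card = n := by
  classical
  have hsymm : ∀ {x y}, y ∈ block S x → x ∈ block S y := fun h =>
    mem_block.2 (mem_block.1 h).symm
  let g : Finset (Fin n) → Fin n := fun b =>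
    if x₀ ∈ b then x₀ else if y₀ ∈ b then y₀ else if hb : b.Nonempty then b.min' hb else x₀
  have hg : ∀ x, g (block S x) ∈ block S x := by
    intro x
    have hx : (block S x).Nonempty := ⟨x, self_mem_block hst x⟩
    simp only [g]
    split_ifs with h1 h2
    exacts [h1, h2, Finset.min'_mem _ _]
  have hgg : ∀ x y, y ∈ block S x → g (block S x) = g (block S y) := fun x y hxy => by
    rw [block_eq_of_mem hsub hxy]
  let R := Finset.univ.image fun x => g (block S x)
  have hR : ∀ r ∈ R, ∀ r' ∈ R, r' ∈ block S r → r = r' := by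
    intro r hr r' hr' hrr
    obtain ⟨x, -, rfl⟩ := Finset.mem_image.1 hr
    obtain ⟨y, -, rfl⟩ := Finset.mem_image.1 hr'
    have h1 := block_eq_of_mem hsub (hg x)
    have h2 := block_eq_of_mem hsub (hg y)
    have h3 := block_eq_of_mem hsub hrr
    change g (block S x) = g (block S y)
    rw [← h1, ← h2, h3]
  refine ⟨R, Finset.mem_image.2 ⟨x₀, Finset.mem_univ _, ?_⟩,
    Finset.mem_image.2 ⟨y₀, Finset.mem_univ _, ?_⟩, hR, ?_⟩
  · simp [g, self_mem_block hst]
  · have : x₀ ∉ block S y₀ := fun h' => h (hsymm h')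
    simp [g, self_mem_block hst, this]
  · rw [← Finset.card_biUnion]
    · have : R.biUnion (block S) = Finset.univ := by
        ext x
        simp only [Finset.mem_biUnion, Finset.mem_univ, iff_true]
        exact ⟨_, Finset.mem_image_of_mem _ (Finset.mem_univ x), hsymm (hg x)⟩
      rw [this, Finset.card_univ, Fintype.card_fin]
    · intro r hr r' hr' hne
      refine Finset.disjoint_left.2 fun z hz hz' => hne (hR r hr r' hr' ?_)
      rw [← block_eq_of_mem hsub hz, block_eq_of_mem hsub hz']
      exact self_mem_block hst r'

/-- Only points above `u` are mapped to points above `v`. -/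
def IsHigh (S : Set (ISemi n)) (u v : Fin n) (τ : ISemi n) : Prop :=
  ∀ s t, τ s = some t → STGe S t v → STGe S s u

/-- All values are below `v`. -/
def IsLow (S : Set (ISemi n)) (v : Fin n) (τ : ISemi n) : Prop :=
  ∀ s t, τ s = some t → STGe S v t

theorem rectCard_high (hsub : IsSubsemigroup S) (hst : Semitransitive S)
    (hcore : ∀ x y, STGe S x y → STGe S y x → core S x = core S y) {u v : Fin n}
    (huv : STGe S u v) :
    RectCard (block S u).card (block S v).card (hitSet S (IsHigh S u v) u v).card := by
  have hne : (hitSet S (IsHigh S u v) u v).Nonempty := by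
    obtain ⟨τ, hτ, h, h'⟩ := exists_reduced_high hsub hst huv
    exact ⟨τ, mem_hitSet.2
      ⟨hτ, ⟨u, self_mem_block hst u, v, self_mem_block hst v, h⟩, h'⟩⟩
  refine ⟨hne.card_pos, hitSet_card hsub hst hcore (fun h hh ψ hψ s t hs ht => ?_)
    (fun h hh ψ hψ s t hs ht => ?_) hne⟩ <;>
    obtain ⟨r, h1, h2⟩ := (PEquiv.trans_eq_some _ _ _ _).1 hs
  · exact STGe.trans hsub ⟨h, hh, h1⟩ (hψ _ _ h2 ht)
  · exact hψ _ _ h1 (STGe.trans hsub ⟨h, hh, h2⟩ ht)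

theorem rectCard_low (hsub : IsSubsemigroup S) (hst : Semitransitive S)
    (hcore : ∀ x y, STGe S x y → STGe S y x → core S x = core S y) {u v : Fin n}
    (huv : ∃ τ, IsCoreReduced S u v τ ∧ τ u = some v ∧ IsLow S v τ) :
    RectCard (block S u).card (block S v).card (hitSet S (IsLow S v) u v).card := by
  have hne : (hitSet S (IsLow S v) u v).Nonempty := by
    obtain ⟨τ, hτ, h, h'⟩ := huv
    exact ⟨τ, mem_hitSet.2
      ⟨hτ, ⟨u, self_mem_block hst u, v, self_mem_block hst v, h⟩, h'⟩⟩
  refine ⟨hne.card_pos, hitSet_card hsub hst hcore (fun h hh ψ hψ s t hs => ?_)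
    (fun h hh ψ hψ s t hs => ?_) hne⟩ <;>
    obtain ⟨r, h1, h2⟩ := (PEquiv.trans_eq_some _ _ _ _).1 hs
  · exact hψ _ _ h2
  · exact (hψ _ _ h1).trans hsub ⟨h, hh, h2⟩

theorem two_mul_add_one_le_of_two_cores (hsub : IsSubsemigroup S) (hst : Semitransitive S)
    (hbot : (⊥ : ISemi n) ∈ S)
    (hcore : ∀ x y, STGe S x y → STGe S y x → core S x = core S y)
    (hdisj : ∀ x y, y ∈ core S x → core S y = core S x) {x₀ y₀ : Fin n}
    (hmax : ∀ y, core S y = core S y₀ → STGe S y₀ y)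
    (hmin : ∀ x, core S x = core S x₀ → STGe S x y₀ → STGe S x x₀) (h₀ : STGe S x₀ y₀)
    (hne : core S x₀ ≠ core S y₀) (htwo : ∀ z, core S z = core S x₀ ∨ core S z = core S y₀)
    {p : ℕ} (hp : ∀ d, d ∣ n → d < n → d ≤ p) : 2 * n + 1 ≤ p + S.ncard := by
  classical
  have hnb : y₀ ∉ block S x₀ := fun h => hne (hcore _ _ (mem_block.1 h).1 (mem_block.1 h).2)
  obtain ⟨R, hx₀, hy₀, hR, hsum⟩ := exists_block_transversal hsub hst hnb
  let U : Fin n → Prop := fun c => core S c = core S x₀ ∧ STGe S c y₀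
  have hU : ∀ c, ¬ U c → STGe S y₀ c := by
    intro c hc
    obtain h | h := htwo c
    · exact (STGe.total hst y₀ c).resolve_right fun h' => hc ⟨h, h'⟩
    · exact hmax c h
  let Q₁ : Fin n → Finset (ISemi n) := fun c =>
    if U c then hitSet S (IsHigh S c x₀) c x₀ else hitSet S (IsLow S c) x₀ c
  let Q₂ : Fin n → Finset (ISemi n) := fun c =>
    if U c then hitSet S (IsHigh S c y₀) c y₀ else hitSet S (IsLow S c) y₀ c
  have hlow : ∀ c, ¬ U c → ∃ τ, IsCoreReduced S y₀ c τ ∧ τ y₀ = some c ∧ IsLow S c τ := by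
    intro c hc
    obtain ⟨τ, h1, h2, h3⟩ := exists_reduced_low hsub hst (hU c hc)
    exact ⟨τ, h1, h2, fun s t hs => h3 s t (hmax s (hdisj _ _ (h1.2 _ _ hs).1)) hs⟩
  have hF : ∀ c, RectCard (block S c).card (block S x₀).card (Q₁ c).card := by
    intro c
    by_cases hc : U c
    · simp only [Q₁, if_pos hc]
      exact rectCard_high hsub hst hcore (hmin c hc.1 hc.2)
    · simp only [Q₁, if_neg hc]
      refine (rectCard_low hsub hst hcore ?_).symm
      obtain ⟨τ, h1, h2, h3⟩ := hlow c hc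
      obtain ⟨σ, h4, h5⟩ := exists_reduced hsub hst h₀
      refine ⟨σ.trans τ, h4.trans hsub h1, ISemi.trans_some h5 h2, fun s t hs => ?_⟩
      obtain ⟨r, -, h6⟩ := (PEquiv.trans_eq_some _ _ _ _).1 hs
      exact h3 _ _ h6
  have hG : ∀ c, RectCard (block S c).card (block S y₀).card (Q₂ c).card := by
    intro c
    by_cases hc : U c
    · simp only [Q₂, if_pos hc]
      exact rectCard_high hsub hst hcore hc.2
    · simp only [Q₂, if_neg hc]
      exact (rectCard_low hsub hst hcore (hlow c hc)).symm
  have mem₁ : ∀ c τ, τ ∈ Q₁ c → (τ ∈ S ∧ (∃ s t, τ s = some t) ∧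
      ∀ s t, τ s = some t → core S s = core S x₀) ∧
      ((U c ∧ (∀ s t, τ s = some t → core S t = core S x₀) ∧ (∃ s t, τ s = some t ∧
        STGe S c s ∧ STGe S t x₀) ∧ IsHigh S c x₀ τ) ∨
      (¬ U c ∧ (∀ s t, τ s = some t → core S t = core S c) ∧
        (∃ s t, τ s = some t ∧ STGe S t c) ∧ IsLow S c τ)) := by
    intro c τ hτ
    by_cases hc : U c
    · simp only [Q₁, if_pos hc] at hτ
      obtain ⟨h1, ⟨s, hs, t, ht, hst'⟩, h2⟩ := mem_hitSet.1 hτ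
      exact ⟨⟨h1.1, ⟨s, t, hst'⟩, fun s t h => (hdisj _ _ (h1.2 s t h).1).trans hc.1⟩,
        .inl ⟨hc, fun s t h => hdisj _ _ (h1.2 s t h).2,
          ⟨s, t, hst', (mem_block.1 hs).1, (mem_block.1 ht).2⟩, h2⟩⟩
    · simp only [Q₁, if_neg hc] at hτ
      obtain ⟨h1, ⟨s, hs, t, ht, hst'⟩, h2⟩ := mem_hitSet.1 hτ
      exact ⟨⟨h1.1, ⟨s, t, hst'⟩, fun s t h => hdisj _ _ (h1.2 s t h).1⟩,
        .inr ⟨hc, fun s t h => hdisj _ _ (h1.2 s t h).2, ⟨s, t, hst', (mem_block.1 ht).2⟩, h2⟩⟩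
  have mem₂ : ∀ c τ, τ ∈ Q₂ c → (τ ∈ S ∧ (∃ s t, τ s = some t)) ∧
      ((U c ∧ (∀ s t, τ s = some t → core S s = core S x₀ ∧ core S t = core S y₀) ∧
        (∃ s t, τ s = some t ∧ STGe S c s ∧ STGe S t y₀) ∧ IsHigh S c y₀ τ) ∨
      (¬ U c ∧ (∀ s t, τ s = some t → core S s = core S y₀) ∧
        (∃ s t, τ s = some t ∧ STGe S t c) ∧ IsLow S c τ)) := by
    intro c τ hτ
    by_cases hc : U c
    · simp only [Q₂, if_pos hc] at hτ
      obtain ⟨h1, ⟨s, hs, t, ht, hst'⟩, h2⟩ := mem_hitSet.1 hτ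
      exact ⟨⟨h1.1, s, t, hst'⟩, .inl ⟨hc, fun s t h =>
        ⟨(hdisj _ _ (h1.2 s t h).1).trans hc.1, hdisj _ _ (h1.2 s t h).2⟩,
          ⟨s, t, hst', (mem_block.1 hs).1, (mem_block.1 ht).2⟩, h2⟩⟩
    · simp only [Q₂, if_neg hc] at hτ
      obtain ⟨h1, ⟨s, hs, t, ht, hst'⟩, h2⟩ := mem_hitSet.1 hτ
      exact ⟨⟨h1.1, s, t, hst'⟩, .inr ⟨hc, fun s t h => hdisj _ _ (h1.2 s t h).1,
        ⟨s, t, hst', (mem_block.1 ht).2⟩, h2⟩⟩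
  have d₁ : ∀ c c' τ, τ ∈ Q₁ c → τ ∈ Q₁ c' → STGe S c c' := by
    intro c c' τ hτ hτ'
    obtain ⟨-, ⟨hc, hi, ⟨s, t, hs, hcs, htx⟩, hH⟩ | ⟨hc, hi, ⟨s, t, hs, htc⟩, hL⟩⟩ :=
      mem₁ c τ hτ <;>
    obtain ⟨-, ⟨hc', hi', ⟨s', t', hs', hcs', htx'⟩, hH'⟩ | ⟨hc', hi', ⟨s', t', hs', htc'⟩, hL'⟩⟩ :=
      mem₁ c' τ hτ'
    · exact hcs.trans hsub (hH' _ _ hs htx)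
    · exact absurd ⟨(hi' _ _ hs).symm.trans (hi _ _ hs),
        ((hL' _ _ hs).trans hsub htx).trans hsub h₀⟩ hc'
    · exact absurd ⟨(hi _ _ hs').symm.trans (hi' _ _ hs'),
        ((hL _ _ hs').trans hsub htx').trans hsub h₀⟩ hc
    · exact (hL _ _ hs').trans hsub htc'
  have d₂ : ∀ c c' τ, τ ∈ Q₂ c → τ ∈ Q₂ c' → STGe S c c' := by
    intro c c' τ hτ hτ'
    obtain ⟨-, ⟨hc, hi, ⟨s, t, hs, hcs, htx⟩, hH⟩ | ⟨hc, hi, ⟨s, t, hs, htc⟩, hL⟩⟩ :=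
      mem₂ c τ hτ <;>
    obtain ⟨-, ⟨hc', hi', ⟨s', t', hs', hcs', htx'⟩, hH'⟩ | ⟨hc', hi', ⟨s', t', hs', htc'⟩, hL'⟩⟩ :=
      mem₂ c' τ hτ'
    · exact hcs.trans hsub (hH' _ _ hs htx)
    · exact absurd ((hi _ _ hs).1.symm.trans (hi' _ _ hs)) hne
    · exact absurd ((hi' _ _ hs).1.symm.trans (hi _ _ hs)) hne
    · exact (hL _ _ hs').trans hsub htc'
  have d₁₂ : ∀ c c' τ, τ ∈ Q₁ c → τ ∈ Q₂ c' → c ∈ block S y₀ := by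
    intro c c' τ hτ hτ'
    obtain ⟨⟨-, -, hd⟩, h⟩ := mem₁ c τ hτ
    obtain ⟨-, ⟨hc', hi', ⟨s, t, hs, -, hty⟩, -⟩ | ⟨hc', hi', ⟨s, t, hs, -⟩, -⟩⟩ := mem₂ c' τ hτ'
    · obtain ⟨hc, hi, -⟩ | ⟨hc, hi, -, hL⟩ := h
      · exact absurd ((hi _ _ hs).symm.trans (hi' _ _ hs).2) hne
      · exact mem_block.2 ⟨hmax c ((hi _ _ hs).symm.trans (hi' _ _ hs).2),
          (hL _ _ hs).trans hsub hty⟩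
    · exact absurd ((hd _ _ hs).symm.trans (hi' _ _ hs)) hne
  have hcount : 1 + (∑ c ∈ R.erase y₀, (Q₁ c).card + ∑ c ∈ R, (Q₂ c).card) ≤ S.ncard := by
    have e₁ : ((R.erase y₀).biUnion Q₁).card = ∑ c ∈ R.erase y₀, (Q₁ c).card := by
      refine Finset.card_biUnion fun c hc c' hc' hcc => Finset.disjoint_left.2 fun τ h h' => hcc ?_
      exact hR c (Finset.mem_of_mem_erase hc) c' (Finset.mem_of_mem_erase hc')
        (mem_block.2 ⟨d₁ _ _ _ h h', d₁ _ _ _ h' h⟩)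
    have e₂ : (R.biUnion Q₂).card = ∑ c ∈ R, (Q₂ c).card := by
      refine Finset.card_biUnion fun c hc c' hc' hcc => Finset.disjoint_left.2 fun τ h h' => hcc ?_
      exact hR c hc c' hc' (mem_block.2 ⟨d₂ _ _ _ h h', d₂ _ _ _ h' h⟩)
    have e₃ : Disjoint ((R.erase y₀).biUnion Q₁) (R.biUnion Q₂) := by
      refine Finset.disjoint_left.2 fun τ h h' => ?_
      obtain ⟨c, hc, hτ⟩ := Finset.mem_biUnion.1 h
      obtain ⟨c', -, hτ'⟩ := Finset.mem_biUnion.1 h'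
      obtain ⟨hc1, hc2⟩ := Finset.mem_erase.1 hc
      exact hc1 (hR y₀ hy₀ c hc2 (d₁₂ _ _ _ hτ hτ')).symm
    have e₄ : (⊥ : ISemi n) ∉ (R.erase y₀).biUnion Q₁ ∪ R.biUnion Q₂ := by
      intro h
      obtain h | h := Finset.mem_union.1 h <;> obtain ⟨c, -, hc⟩ := Finset.mem_biUnion.1 h
      · obtain ⟨⟨-, ⟨s, t, hs⟩, -⟩, -⟩ := mem₁ _ _ hc
        simp at hs
      · obtain ⟨⟨-, ⟨s, t, hs⟩⟩, -⟩ := mem₂ _ _ hc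
        simp at hs
    rw [← e₁, ← e₂, ← Finset.card_union_of_disjoint e₃, add_comm,
      ← Finset.card_insert_of_notMem e₄, Set.ncard_eq_toFinset_card S]
    refine Finset.card_le_card fun τ hτ => (Set.Finite.mem_toFinset _).2 ?_
    obtain rfl | hτ := Finset.mem_insert.1 hτ
    · exact hbot
    · obtain h | h := Finset.mem_union.1 hτ <;> obtain ⟨c, -, hc⟩ := Finset.mem_biUnion.1 h
      · exact (mem₁ _ _ hc).1.1
      · exact (mem₂ _ _ hc).1.1
  have := rectCard_sum (c := fun r => (block S r).card) (F := fun r => (Q₁ r).card)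
    (G := fun r => (Q₂ r).card) hx₀ hy₀ (fun h => hne (h ▸ rfl))
    (fun r _ => Finset.card_pos.2 ⟨r, self_mem_block hst r⟩) (fun r _ => hF r) (fun r _ => hG r)
    (p := p) (by simpa only [hsum] using hp)
  simp only [hsum] at this
  omega

end Count

section CoreClasses

variable {n : ℕ} {S : Set (ISemi n)}

theorem exists_greatest (hsub : IsSubsemigroup S) (hst : Semitransitive S) {Z : Finset (Fin n)}
    (hZ : Z.Nonempty) : ∃ m ∈ Z, ∀ y ∈ Z, STGe S m y := by
  induction hZ using Finset.Nonempty.cons_induction with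
  | singleton a => exact ⟨a, by simp, by simpa using STGe.refl hst a⟩
  | cons a s ha hs ih =>
    obtain ⟨m, hm, hmax⟩ := ih
    obtain h | h := STGe.total hst m a
    · refine ⟨m, Finset.mem_cons_of_mem hm, fun y hy => ?_⟩
      obtain rfl | hy := Finset.mem_cons.1 hy
      exacts [h, hmax y hy]
    · refine ⟨a, Finset.mem_cons_self a s, fun y hy => ?_⟩
      obtain rfl | hy := Finset.mem_cons.1 hy
      exacts [STGe.refl hst y, h.trans hsub (hmax y hy)]

theorem exists_least (hsub : IsSubsemigroup S) (hst : Semitransitive S) {Z : Finset (Fin n)}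
    (hZ : Z.Nonempty) : ∃ m ∈ Z, ∀ y ∈ Z, STGe S y m := by
  induction hZ using Finset.Nonempty.cons_induction with
  | singleton a => exact ⟨a, by simp, by simpa using STGe.refl hst a⟩
  | cons a s ha hs ih =>
    obtain ⟨m, hm, hmin⟩ := ih
    obtain h | h := STGe.total hst a m
    · refine ⟨m, Finset.mem_cons_of_mem hm, fun y hy => ?_⟩
      obtain rfl | hy := Finset.mem_cons.1 hy
      exacts [h, hmin y hy]
    · refine ⟨a, Finset.mem_cons_self a s, fun y hy => ?_⟩
      obtain rfl | hy := Finset.mem_cons.1 hy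
      exacts [STGe.refl hst y, (hmin y hy).trans hsub h]

theorem IsCoreReduced.core_eq (hsub : IsSubsemigroup S) (hst : Semitransitive S)
    {a b c d : Fin n} {φ : ISemi n} (h : IsCoreReduced S a b φ) (hab : φ a = some b)
    (h' : IsCoreReduced S c d φ) (hcd : φ c = some d) :
    core S a = core S c ∧ core S b = core S d := by
  obtain ⟨h1, h2⟩ := h.2 _ _ hcd
  obtain ⟨h3, h4⟩ := h'.2 _ _ hab
  exact ⟨(core_subset hsub hst h3).antisymm (core_subset hsub hst h1),
    (core_subset hsub hst h4).antisymm (core_subset hsub hst h2)⟩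

/-- Each point contributes an element of `S` inside its own core class, and each point of `X` an
element between its core class and another one. -/
theorem one_add_add_card_le (hsub : IsSubsemigroup S) (hst : Semitransitive S)
    (hbot : (⊥ : ISemi n) ∈ S) (X : Finset (Fin n)) (d : Fin n → Fin n)
    (hd : ∀ x ∈ X, core S (d x) ≠ core S x)
    (hdd : ∀ x ∈ X, ∀ y ∈ X, core S x = core S y → d x = d y)
    (hno : ∀ x ∈ X, ∀ y ∈ X, core S x = core S (d y) → core S (d x) ≠ core S y) :
    1 + (n + X.card) ≤ S.ncard := by
  classical
  have hF : ∀ x, ∃ φ, (IsCoreReduced S x (d x) φ ∧ φ x = some (d x)) ∨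
      (IsCoreReduced S (d x) x φ ∧ φ (d x) = some x) := fun x => by
    obtain h | h := STGe.total hst x (d x)
    · obtain ⟨φ, hφ⟩ := exists_reduced hsub hst h
      exact ⟨φ, .inl hφ⟩
    · obtain ⟨φ, hφ⟩ := exists_reduced hsub hst h
      exact ⟨φ, .inr hφ⟩
  choose F hF using hF
  have ht : ∀ K : Finset (Fin n), ∃ m : Option (Fin n), ∀ x, core S x = K →
      ∃ t, m = some t ∧ core S t = K ∧ STGe S t x := by
    intro K
    by_cases hK : ∃ x, core S x = K
    · obtain ⟨m, hm, hmax⟩ := exists_greatest hsub hst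
        (Z := Finset.univ.filter fun x => core S x = K) (by
          obtain ⟨x, hx⟩ := hK
          exact ⟨x, by simpa using hx⟩)
      exact ⟨some m, fun x hx => ⟨m, rfl, by simpa using hm, hmax x (by simpa using hx)⟩⟩
    · exact ⟨none, fun x hx => absurd ⟨x, hx⟩ hK⟩
  choose m hm using ht
  choose t htm htc htx using fun x => hm (core S x) x rfl
  choose G hG hGt using fun x => exists_reduced hsub hst (htx x)
  have hFinj : Set.InjOn F X := by
    intro x hx y hy hxy
    have h1 := hF x
    have h2 := hF y
    rw [← hxy] at h2
    obtain ⟨h1, h1'⟩ | ⟨h1, h1'⟩ := h1 <;> obtain ⟨h2, h2'⟩ | ⟨h2, h2'⟩ := h2 <;>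
      obtain ⟨h3, h4⟩ := h1.core_eq hsub hst h1' h2 h2'
    · rw [hdd x hx y hy h3] at h1'
      exact ISemi.inj h1' h2'
    · exact absurd h4 (hno x hx y hy h3)
    · exact absurd h3 (hno x hx y hy h4)
    · rw [hdd x hx y hy h4] at h1'
      exact ISemi.det h1' h2'
  have hGinj : Function.Injective G := by
    intro x y hxy
    have h2 := hG y
    have h2' := hGt y
    rw [← hxy] at h2 h2'
    have h3 := ((hG x).core_eq hsub hst (hGt x) h2 h2').2
    have h4 : t x = t y := Option.some.inj ((htm x).symm.trans ((congrArg m h3).trans (htm y)))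
    have h1' := hGt x
    rw [h4] at h1'
    exact ISemi.det h1' h2'
  have hdisj : Disjoint (Finset.univ.image G) (X.image F) := by
    refine Finset.disjoint_left.2 fun τ h h' => ?_
    obtain ⟨x, -, rfl⟩ := Finset.mem_image.1 h
    obtain ⟨y, hy, hxy⟩ := Finset.mem_image.1 h'
    have h2 := hF y
    rw [hxy] at h2
    obtain ⟨h2, h2'⟩ | ⟨h2, h2'⟩ := h2 <;>
      obtain ⟨h3, h4⟩ := (hG x).core_eq hsub hst (hGt x) h2 h2'
    · exact hd y hy (h4.symm.trans ((htc x).symm.trans h3))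
    · exact hd y hy (h3.symm.trans ((htc x).trans h4))
  have hbot' : (⊥ : ISemi n) ∉ Finset.univ.image G ∪ X.image F := by
    intro h
    obtain h | h := Finset.mem_union.1 h <;> obtain ⟨x, hx, h⟩ := Finset.mem_image.1 h
    · have := hGt x
      simp [h] at this
    · have := hF x
      simp [h] at this
  have hcard : (Finset.univ.image G ∪ X.image F).card = n + X.card := by
    rw [Finset.card_union_of_disjoint hdisj, Finset.card_image_of_injective _ hGinj,
      Finset.card_image_of_injOn hFinj, Finset.card_univ, Fintype.card_fin]
  rw [← hcard, add_comm, ← Finset.card_insert_of_notMem hbot', Set.ncard_eq_toFinset_card S]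
  refine Finset.card_le_card fun τ hτ => (Set.Finite.mem_toFinset _).2 ?_
  obtain rfl | hτ := Finset.mem_insert.1 hτ
  · exact hbot
  · obtain h | h := Finset.mem_union.1 hτ <;> obtain ⟨x, -, rfl⟩ := Finset.mem_image.1 h
    · exact (hG x).1
    · obtain h | h := hF x
      exacts [h.1.1, h.1.1]

theorem one_add_two_mul_le_of_three_cores (hsub : IsSubsemigroup S) (hst : Semitransitive S)
    (hbot : (⊥ : ISemi n) ∈ S) {u v w : Fin n} (huv : core S u ≠ core S v)
    (hvw : core S v ≠ core S w) (huw : core S u ≠ core S w) : 1 + 2 * n ≤ S.ncard := by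
  classical
  let d : Fin n → Fin n := fun x =>
    if core S x = core S u then v else if core S x = core S v then w else u
  have := one_add_add_card_le hsub hst hbot Finset.univ d (by grind) (by grind) (by grind)
  rw [Finset.card_univ, Fintype.card_fin] at this
  omega

end CoreClasses

/-- if `p` is the greatest proper divisor of `n ≥ 2`, then every
semitransitive subsemigroup of the singular part `I_n \ S_n` has at least
`2n - p + 1` elements. -/
theorem stmt0 (n p : ℕ) (hn : 2 ≤ n)
    (hpd : p ∣ n) (hplt : p < n) (hpmax : ∀ d : ℕ, d ∣ n → d < n → d ≤ p)
    (S : Set (ISemi n))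
    (hsub : IsSubsemigroup S)
    (hsing : ∀ φ ∈ S, IsSingular φ)
    (hst : Semitransitive S) :
    2 * n - p + 1 ≤ S.ncard := by
  classical
  have hbot := bot_mem (by omega) hsub hsing hst
  have hproper : ∀ x, ∃ u, u ∉ core S x := by
    intro x
    obtain ⟨e, he, hex⟩ := exists_core_idempotent hsub hst x
    obtain ⟨u, hu⟩ := hsing e he
    refine ⟨u, fun h => ?_⟩
    rw [(hex u u).2 ⟨rfl, h⟩] at hu
    cases hu
  by_cases h3 : ∃ u v w, core S u ≠ core S v ∧ core S v ≠ core S w ∧ core S u ≠ core S w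
  · obtain ⟨u, v, w, huv, hvw, huw⟩ := h3
    have := one_add_two_mul_le_of_three_cores hsub hst hbot huv hvw huw
    omega
  have htwo : ∀ u v w, core S u ≠ core S v → core S w = core S u ∨ core S w = core S v := by
    intro u v w huv
    by_contra! h
    exact h3 ⟨u, v, w, huv, h.2.symm, h.1.symm⟩
  have hdisj : ∀ x y, y ∈ core S x → core S y = core S x := by
    intro x y hy
    by_contra hne
    obtain ⟨w, hw⟩ := hproper x
    obtain h | h := htwo x y w (Ne.symm hne)
    · exact hw (h ▸ self_mem_core w)
    · exact hw (core_subset hsub hst hy (h ▸ self_mem_core w))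
  by_cases hcore : ∀ x y, STGe S x y → STGe S y x → core S x = core S y
  · obtain ⟨x₁, -, hx₁⟩ := exists_greatest hsub hst
      (Z := Finset.univ) ⟨(⟨0, by omega⟩ : Fin n), Finset.mem_univ _⟩
    obtain ⟨y₀, hy₀, hmax⟩ := exists_greatest hsub hst
      (Z := Finset.univ.filter fun y => core S y ≠ core S x₁) (by
        obtain ⟨u, hu⟩ := hproper x₁
        exact ⟨u, by simpa using fun h : core S u = core S x₁ => hu (h ▸ self_mem_core u)⟩)
    obtain ⟨x₀, hx₀, hmin⟩ := exists_least hsub hst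
      (Z := Finset.univ.filter fun x => core S x = core S x₁ ∧ STGe S x y₀)
      ⟨x₁, by simpa using hx₁ y₀ (Finset.mem_univ _)⟩
    simp only [Finset.mem_filter, Finset.mem_univ, true_and] at hy₀ hmax hx₀ hmin
    have hne : core S x₀ ≠ core S y₀ := hx₀.1 ▸ hy₀.symm
    have := two_mul_add_one_le_of_two_cores hsub hst hbot hcore hdisj (x₀ := x₀) (y₀ := y₀)
      (fun y hy => hmax y (hy ▸ hy₀)) (fun x hx h => hmin x ⟨hx.trans hx₀.1, h⟩) hx₀.2 hne
      (fun z => htwo x₀ y₀ z hne) hpmax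
    omega
  · push Not at hcore
    obtain ⟨x, y, hxy, hyx, hne⟩ := hcore
    have hcard : (core S y).card = (core S x).card :=
      (core_card_le hsub hst hyx hxy).antisymm (core_card_le hsub hst hxy hyx)
    have hunion : core S x ∪ core S y = Finset.univ := by
      refine Finset.eq_univ_iff_forall.2 fun w => Finset.mem_union.2 ?_
      exact (htwo x y w hne).imp (fun h : core S w = core S x => h ▸ self_mem_core w)
        (fun h : core S w = core S y => h ▸ self_mem_core w)
    have hn' : n = 2 * (core S x).card := by
      have := Finset.card_union_of_disjoint (s := core S x) (t := core S y)
        (Finset.disjoint_left.2 fun w hw hw' => hne ((hdisj _ _ hw).symm.trans (hdisj _ _ hw')))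
      rw [hunion, Finset.card_univ, Fintype.card_fin] at this
      omega
    have := one_add_add_card_le hsub hst hbot (core S x) (fun _ => y)
      (fun a ha => by rw [hdisj _ _ ha]; exact hne.symm) (fun _ _ _ _ _ => rfl)
      (fun a ha _ _ h => absurd ((hdisj _ _ ha).symm.trans h) hne)
    have hp := hpmax (core S x).card ⟨2, by omega⟩ (by omega)
    omega
end

section
/- Let n ≥ 2 and let p be the greatest proper divisor of n (that is, p = n/q where q is the smallest prime divisor of n). Then the minimal cardinality of a semitransitive subsemigroup of the singular part I_n \ S_n of the symmetric inverse semigroup equals 2n − p + 1; i.e., some semitransitive subsemigroup of I_n \ S_n has cardinality 2n − p + 1 and none has smaller cardinality. -/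
namespace ISemi

variable {n : ℕ} {S : Set (ISemi n)}

/-- Partial permutations form a monoid with zero, the zero being the empty map. -/
instance : MonoidWithZero (ISemi n) where
  mul a b := a.trans b
  one := PEquiv.refl _
  zero := ⊥
  mul_assoc := PEquiv.trans_assoc
  one_mul := PEquiv.refl_trans
  mul_one := PEquiv.trans_refl
  zero_mul := PEquiv.bot_trans
  mul_zero := PEquiv.trans_bot

instance : Finite (ISemi n) :=
  Finite.of_injective (fun φ : ISemi n => (φ : Fin n → Option (Fin n))) DFunLike.coe_injective

lemma mul_eq_some {a b : ISemi n} {x z : Fin n} :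
    (a * b) x = some z ↔ ∃ y, a x = some y ∧ b y = some z :=
  PEquiv.trans_eq_some a b x z

lemma zero_apply (x : Fin n) : (0 : ISemi n) x = none := rfl

lemma one_apply (x : Fin n) : (1 : ISemi n) x = some x := rfl

lemma ne_zero_of_apply {a : ISemi n} {x y : Fin n} (h : a x = some y) : a ≠ 0 := by
  rintro rfl
  simp [zero_apply] at h

lemma apply_inj {a : ISemi n} {x y z : Fin n} (hx : a x = some z) (hy : a y = some z) : x = y :=
  a.inj hx hy

lemma ext_some_s2 {a b : ISemi n} (h : ∀ x y, a x = some y ↔ b x = some y) : a = b :=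
  PEquiv.ext fun x => Option.ext fun y => h x y

lemma exists_apply_of_ne_zero {a : ISemi n} (h : a ≠ 0) : ∃ x y, a x = some y := by
  by_contra! hc
  exact h (ext_some_s2 fun x y => by simp [hc x y, zero_apply])

lemma eq_of_idem {e : ISemi n} (he : e * e = e) {x y : Fin n} (h : e x = some y) : x = y := by
  have h' := h
  rw [← he, mul_eq_some] at h'
  obtain ⟨z, hz, hzy⟩ := h'
  obtain rfl : y = z := by simpa [h] using hz
  exact apply_inj h hzy

lemma apply_self_of_idem {e : ISemi n} (he : e * e = e) {x y : Fin n} (h : e x = some y) :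
    e x = some x := by
  rw [h, eq_of_idem he h]

lemma idem_mul_eq_some {e φ : ISemi n} (he : e * e = e) {x y : Fin n} :
    (e * φ) x = some y ↔ e x = some x ∧ φ x = some y := by
  rw [mul_eq_some]
  constructor
  · rintro ⟨z, hz, hzy⟩
    obtain rfl := eq_of_idem he hz
    exact ⟨hz, hzy⟩
  · rintro ⟨h1, h2⟩
    exact ⟨x, h1, h2⟩

lemma mul_idem_eq_some {e φ : ISemi n} (he : e * e = e) {x y : Fin n} :
    (φ * e) x = some y ↔ φ x = some y ∧ e y = some y := by
  rw [mul_eq_some]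
  constructor
  · rintro ⟨z, hz, hzy⟩
    obtain rfl := eq_of_idem he hzy
    exact ⟨hz, hzy⟩
  · rintro ⟨h1, h2⟩
    exact ⟨y, h1, h2⟩

lemma idem_comm {e f : ISemi n} (he : e * e = e) (hf : f * f = f) : e * f = f * e := by
  refine ext_some_s2 fun x y => ?_
  rw [idem_mul_eq_some he, mul_idem_eq_some he]
  constructor
  · rintro ⟨h1, h2⟩
    obtain rfl := eq_of_idem hf h2
    exact ⟨h2, h1⟩
  · rintro ⟨h1, h2⟩
    obtain rfl := eq_of_idem hf h1
    exact ⟨h2, h1⟩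

lemma idem_mul_idem {e f : ISemi n} (he : e * e = e) (hf : f * f = f) :
    (e * f) * (e * f) = e * f := by
  rw [mul_assoc, ← mul_assoc f, ← idem_comm he hf, mul_assoc, hf, ← mul_assoc, he]

/-- Every element of a finite monoid has an idempotent positive power. -/
lemma exists_pow_idem {M : Type*} [Monoid M] [Finite M] (a : M) :
    ∃ k, a ^ (k + 1) * a ^ (k + 1) = a ^ (k + 1) := by
  obtain ⟨i, j, hij, h⟩ := Finite.exists_ne_map_eq_of_infinite (fun k : ℕ => a ^ k)
  wlog hlt : i < j generalizing i j
  · exact this j i hij.symm h.symm (by omega)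
  obtain ⟨d, rfl⟩ := Nat.exists_eq_add_of_lt hlt
  have step : ∀ t, a ^ (i + t + (d + 1)) = a ^ (i + t) := fun t => by
    have h' : a ^ i = a ^ (i + d + 1) := h
    rw [show i + t + (d + 1) = (i + d + 1) + t by ring, pow_add, ← h', ← pow_add]
  have step' : ∀ m t, a ^ (i + t + m * (d + 1)) = a ^ (i + t) := by
    intro m
    induction m with
    | zero => simp
    | succ m ih =>
      intro t
      rw [show i + t + (m + 1) * (d + 1) = i + (t + m * (d + 1)) + (d + 1) by ring, step,
        ← add_assoc, ih]
  refine ⟨i * (d + 1) + d, ?_⟩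
  have := step' (i + 1) (i * d + d + 1)
  rw [← pow_add]
  convert this using 2 <;> ring

lemma pow_succ_mem {M : Type*} [Monoid M] {S : Set M} (hS : ∀ a ∈ S, ∀ b ∈ S, a * b ∈ S)
    {a : M} (ha : a ∈ S) (k : ℕ) : a ^ (k + 1) ∈ S := by
  induction k with
  | zero => simpa
  | succ k ih => rw [pow_succ]; exact hS _ ih _ ha

lemma pow_apply_self {a : ISemi n} {x : Fin n} (h : a x = some x) (k : ℕ) :
    (a ^ k) x = some x := by
  induction k with
  | zero => exact one_apply x
  | succ k ih => rw [pow_succ, mul_eq_some]; exact ⟨x, ih, h⟩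

lemma exists_least_idem {P : Set (ISemi n)} (hne : P.Nonempty) (hid : ∀ g ∈ P, g * g = g)
    (hmul : ∀ a ∈ P, ∀ b ∈ P, a * b ∈ P) : ∃ z ∈ P, ∀ g ∈ P, z * g = z := by
  obtain ⟨z, hz⟩ := P.toFinite.exists_minimal hne
  refine ⟨z, hz.prop, fun g hg => ?_⟩
  have hle : z * g ≤ z := fun x y hxy => by
    have h := (mul_idem_eq_some (hid g hg)).1 (Option.mem_def.1 hxy)
    exact h.1
  exact le_antisymm hle (hz.le_of_le (hmul z hz.prop g hg) hle)

section Units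

/-- `a` is invertible in the local monoid of the idempotent `e` of `S`. -/
def LocalUnit (S : Set (ISemi n)) (e a : ISemi n) : Prop :=
  a ∈ S ∧ e * a = a ∧ a * e = a ∧ ∃ b ∈ S, e * b = b ∧ b * e = b ∧ a * b = e ∧ b * a = e

lemma localUnit_of_pow_ne_zero (hS : ∀ a ∈ S, ∀ b ∈ S, a * b ∈ S) {e : ISemi n}
    (he : e * e = e) (hprim : ∀ g ∈ S, g * g = g → g * e = g → g ≠ 0 → g = e)
    {a b : ISemi n} (ha : a ∈ S) (hb : b ∈ S) (hea : e * a = a) (hae : a * e = a)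
    (heb : e * b = b) (hbe : b * e = b) (hpow : ∀ k, (a * b) ^ k ≠ 0) :
    LocalUnit S e a ∧ LocalUnit S e b := by
  obtain ⟨k, hk⟩ := exists_pow_idem (a * b)
  have hab : a * b ∈ S := hS a ha b hb
  have hke : (a * b) ^ (k + 1) = e := by
    refine hprim _ (pow_succ_mem hS hab k) hk ?_ (hpow _)
    rw [pow_succ, mul_assoc, mul_assoc, hbe]
  have he0 : e ≠ 0 := hke ▸ hpow _
  have key : ∀ u ∈ S, ∀ v ∈ S, v * e = v → e * u = u → u * e = u → u * v = e → v * u = e := by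
    intro u hu v hv hve heu hue huv
    refine hprim _ (hS v hv u hu) ?_ (by rw [mul_assoc, hue]) ?_
    · rw [mul_assoc, ← mul_assoc u, huv, heu]
    · intro h0
      apply he0
      rw [← huv, ← hve, ← huv, ← mul_assoc v, h0, zero_mul, mul_zero]
  have h1 : a * (b * (a * b) ^ k * e) = e := by
    rw [← mul_assoc, ← mul_assoc, ← pow_succ', hke, he]
  have h2 : (e * (a * b) ^ k * a) * b = e := by
    rw [mul_assoc, mul_assoc, ← pow_succ, hke, he]
  have m1 : b * (a * b) ^ k * e ∈ S := by
    rw [← hke, mul_assoc, ← pow_add, ← add_assoc]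
    exact hS _ hb _ (pow_succ_mem hS hab _)
  have m2 : e * (a * b) ^ k * a ∈ S := by
    rw [← hke, ← pow_add, show k + 1 + k = (k + k) + 1 by ring]
    exact hS _ (pow_succ_mem hS hab _) _ ha
  have e1 : b * (a * b) ^ k * e * e = b * (a * b) ^ k * e := by rw [mul_assoc, he]
  have e1' : e * (b * (a * b) ^ k * e) = b * (a * b) ^ k * e := by
    rw [← mul_assoc, ← mul_assoc, heb]
  have e2 : e * (e * (a * b) ^ k * a) = e * (a * b) ^ k * a := by
    rw [← mul_assoc, ← mul_assoc, he]
  have e2' : e * (a * b) ^ k * a * e = e * (a * b) ^ k * a := by rw [mul_assoc, hae]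
  exact ⟨⟨ha, hea, hae, _, m1, e1', e1, h1, key a ha _ m1 e1 hea hae h1⟩,
    ⟨hb, heb, hbe, _, m2, e2, e2', key _ m2 b hb hbe e2 e2' h2, h2⟩⟩

lemma LocalUnit.exists_apply {e a : ISemi n} (h : LocalUnit S e a) {u : Fin n}
    (hu : e u = some u) : ∃ v, a u = some v ∧ STGe S u v ∧ STGe S v u ∧ e v = some v := by
  obtain ⟨ha, hea, hae, b, hb, heb, hbe, hab, hba⟩ := h
  have hu' := hu
  rw [← hab, mul_eq_some] at hu'
  obtain ⟨v, hv, hvu⟩ := hu'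
  refine ⟨v, hv, ⟨a, ha, hv⟩, ⟨b, hb, hvu⟩, ?_⟩
  rw [← hba, mul_eq_some]
  exact ⟨u, hvu, hv⟩

lemma LocalUnit.symm {e a : ISemi n} (h : LocalUnit S e a) :
    ∃ b, LocalUnit S e b ∧ a * b = e ∧ b * a = e := by
  obtain ⟨ha, hea, hae, b, hb, heb, hbe, hab, hba⟩ := h
  exact ⟨b, ⟨hb, heb, hbe, a, ha, hea, hae, hba, hab⟩, hab, hba⟩

end Units

section Order

lemma stge_trans (hS : ∀ a ∈ S, ∀ b ∈ S, a * b ∈ S) {x y z : Fin n} (h1 : STGe S x y)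
    (h2 : STGe S y z) : STGe S x z := by
  obtain ⟨a, ha, hxy⟩ := h1
  obtain ⟨b, hb, hyz⟩ := h2
  exact ⟨a * b, hS a ha b hb, mul_eq_some.2 ⟨y, hxy, hyz⟩⟩

lemma stge_total (hst : Semitransitive S) (x y : Fin n) : STGe S x y ∨ STGe S y x := by
  obtain ⟨φ, hφ, h | h⟩ := hst x y
  · exact Or.inl ⟨φ, hφ, h⟩
  · exact Or.inr ⟨φ, hφ, h⟩

lemma stge_refl (hst : Semitransitive S) (x : Fin n) : STGe S x x := by
  simpa using stge_total hst x x

lemma exists_top (hS : ∀ a ∈ S, ∀ b ∈ S, a * b ∈ S) (hst : Semitransitive S)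
    {T : Set (Fin n)} (hT : T.Nonempty) : ∃ t ∈ T, ∀ y ∈ T, STGe S t y := by
  obtain ⟨t, ht, hmax⟩ := Set.exists_max_image T (fun x => {y | STGe S x y}.ncard) T.toFinite hT
  refine ⟨t, ht, fun y hy => ?_⟩
  by_contra hn
  have hyt := (stge_total hst t y).resolve_left hn
  refine absurd (hmax y hy) (not_le.2 (Set.ncard_lt_ncard ?_ (Set.toFinite _)))
  refine ⟨fun z hz => stge_trans hS hyt hz, fun hsub => hn (hsub (stge_refl hst y))⟩

lemma zero_mem (hS : ∀ a ∈ S, ∀ b ∈ S, a * b ∈ S) (hsing : ∀ φ ∈ S, IsSingular φ)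
    (hst : Semitransitive S) (hn : 0 < n) : (0 : ISemi n) ∈ S := by
  obtain ⟨φ, hφ, -⟩ := hst ⟨0, hn⟩ ⟨0, hn⟩
  obtain ⟨k, hk⟩ := exists_pow_idem φ
  obtain ⟨z, ⟨hzS, hz⟩, hmin⟩ := exists_least_idem (P := {g | g ∈ S ∧ g * g = g})
    ⟨_, pow_succ_mem hS hφ k, hk⟩ (fun g hg => hg.2)
    (fun a ha b hb => ⟨hS a ha.1 b hb.1, idem_mul_idem ha.2 hb.2⟩)
  by_cases h0 : z = 0
  · rwa [h0] at hzS
  exfalso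
  obtain ⟨x, y, hxy⟩ := exists_apply_of_ne_zero h0
  have hx := apply_self_of_idem hz hxy
  obtain ⟨w, hw⟩ := hsing z hzS
  have key : ∀ ψ ∈ S, z * ψ = ψ ∨ ψ * z = ψ → z * ψ = ψ ∧ ψ * z = ψ := by
    intro ψ hψ hor
    obtain ⟨k, hk⟩ := exists_pow_idem ψ
    have h1 : z * ψ ^ (k + 1) = z := hmin _ ⟨pow_succ_mem hS hψ k, hk⟩
    have h2 : ψ ^ (k + 1) = z := by
      rcases hor with h | h
      · rw [← h1, pow_succ', ← mul_assoc, h]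
      · rw [← h1, idem_comm hz hk, pow_succ, mul_assoc, h]
    have hcomm : ψ * z = z * ψ := by rw [← h2, ← pow_succ, ← pow_succ']
    rcases hor with h | h
    · exact ⟨h, hcomm.trans h⟩
    · exact ⟨hcomm.symm.trans h, h⟩
  obtain ⟨φ, hφ, h | h⟩ := hst x w
  · have h4 := (key (z * φ) (hS z hzS φ hφ) (Or.inl (by rw [← mul_assoc, hz]))).2
    have h5 : (z * φ * z) x = some w := by rw [h4, mul_eq_some]; exact ⟨x, hx, h⟩
    have h6 := ((mul_idem_eq_some hz).1 h5).2
    simp [hw] at h6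
  · have h4 := (key (φ * z) (hS φ hφ z hzS) (Or.inr (by rw [mul_assoc, hz]))).1
    have h5 : (z * (φ * z)) w = some x := by
      rw [h4, mul_eq_some]
      exact ⟨x, h, hx⟩
    have h6 := ((idem_mul_eq_some hz).1 h5).1
    simp [hw] at h6

end Order

section Arithmetic

/-- Given that `p` bounds all proper divisors of `n`, parts `q i` of a partition of `n` and
common multiples `m i` of `q i` and `a < n`. -/
lemma add_le_sum_add {ι : Type*} (s : Finset ι) (q m : ι → ℕ) {n a p : ℕ} (ha : 0 < a)
    (han : a < n) (hpmax : ∀ d : ℕ, d ∣ n → d < n → d ≤ p) (hq : ∑ i ∈ s, q i = n)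
    (hqpos : ∀ i ∈ s, 0 < q i) (hm : ∀ i ∈ s, 0 < m i) (ham : ∀ i ∈ s, a ∣ m i)
    (hqm : ∀ i ∈ s, q i ∣ m i) : n + a ≤ ∑ i ∈ s, m i + p := by
  classical
  have hle : ∀ i ∈ s, q i ≤ m i := fun i hi => Nat.le_of_dvd (hm i hi) (hqm i hi)
  by_cases hall : ∀ i ∈ s, a ∣ q i
  · have h1 : a ≤ p := hpmax a (hq ▸ Finset.dvd_sum hall) han
    have h2 := Finset.sum_le_sum hle
    omega
  push Not at hall
  obtain ⟨i, hi, hai⟩ := hall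
  have hs1 := Finset.add_sum_erase s q hi
  have hs2 := Finset.add_sum_erase s m hi
  by_cases hall : ∀ j ∈ s.erase i, a ∣ q j
  · have hgn : Nat.gcd a (q i) ∣ n := by
      rw [← hq, ← hs1]
      exact dvd_add (Nat.gcd_dvd_right _ _)
        ((Nat.gcd_dvd_left _ _).trans (Finset.dvd_sum hall))
    have hga : Nat.gcd a (q i) ≤ a := Nat.gcd_le_left _ ha
    have hgp := hpmax _ hgn (by omega)
    have hsum : ∑ j ∈ s.erase i, q j ≤ ∑ j ∈ s.erase i, m j :=
      Finset.sum_le_sum fun j hj => hle j (Finset.mem_of_mem_erase hj)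
    have hlcm : Nat.lcm a (q i) ≤ m i := Nat.le_of_dvd (hm i hi) (Nat.lcm_dvd (ham i hi) (hqm i hi))
    have hgl := Nat.gcd_mul_lcm a (q i)
    have hgpos : 0 < Nat.gcd a (q i) := Nat.gcd_pos_of_pos_left _ ha
    obtain ⟨b, hb⟩ := Nat.gcd_dvd_left a (q i)
    obtain ⟨c, hc⟩ := Nat.gcd_dvd_right a (q i)
    generalize Nat.gcd a (q i) = g at *
    have hl : Nat.lcm a (q i) = b * q i := by
      apply Nat.eq_of_mul_eq_mul_left hgpos
      rw [hgl]
      conv_lhs => rw [hb]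
      ring
    have hcpos : 0 < c := Nat.pos_of_ne_zero fun h => by
      have := hqpos i hi
      simp [h] at hc
      omega
    have hbpos : 0 < b := Nat.pos_of_ne_zero fun h => by simp [h] at hb; omega
    obtain ⟨b, rfl⟩ := Nat.exists_eq_succ_of_ne_zero hbpos.ne'
    have : a + q i ≤ Nat.lcm a (q i) + g := by
      rw [hl]
      have : g * b ≤ b * q i := by rw [hc]; nlinarith [Nat.zero_le (b * g)]
      have : a = g * b + g := by rw [hb, Nat.succ_eq_add_one]; ring
      rw [Nat.succ_mul]
      omega
    omega
  push Not at hall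
  obtain ⟨j, hj, haj⟩ := hall
  have half : ∀ k ∈ s, ¬ a ∣ q k → 2 * q k ≤ m k := by
    intro k hk hak
    obtain ⟨c, hc⟩ := hqm k hk
    have hmk := hm k hk
    match c, hc with
    | 0, hc => omega
    | 1, hc => exact absurd (by simpa [hc] using ham k hk) hak
    | c + 2, hc => rw [hc]; nlinarith [Nat.zero_le (q k * c)]
  have hs3 := Finset.add_sum_erase _ q hj
  have hs4 := Finset.add_sum_erase _ m hj
  have hjs := Finset.mem_of_mem_erase hj
  have hsum : ∑ k ∈ (s.erase i).erase j, q k ≤ ∑ k ∈ (s.erase i).erase j, m k :=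
    Finset.sum_le_sum fun k hk =>
      hle k (Finset.mem_of_mem_erase (Finset.mem_of_mem_erase hk))
  have := half i hi hai
  have := half j hjs haj
  have := Nat.le_of_dvd (hm i hi) (ham i hi)
  have := Nat.le_of_dvd (hm j hjs) (ham j hjs)
  omega

/-- If the fibres of `π : M → A` embed into each other, then they have equal size. -/
lemma ncard_dvd_ncard_of_fiber_embed {T X : Type*} [Finite T] [Finite X] {M : Set T} {A : Set X}
    (π : T → X) (hπ : ∀ φ ∈ M, π φ ∈ A)
    (hF : ∀ u ∈ A, ∀ v ∈ A, ∃ F : T → T, (∀ φ ∈ M, π φ = u → F φ ∈ M ∧ π (F φ) = v) ∧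
      Set.InjOn F {φ | φ ∈ M ∧ π φ = u}) : A.ncard ∣ M.ncard := by
  classical
  have := Fintype.ofFinite T
  have := Fintype.ofFinite X
  rw [Set.ncard_eq_toFinset_card' A, Set.ncard_eq_toFinset_card' M,
    Finset.card_eq_sum_card_fiberwise (f := π) (s := M.toFinset) (t := A.toFinset)
      (by intro φ hφ; simpa using hπ φ (by simpa using hφ))]
  rcases A.eq_empty_or_nonempty with rfl | ⟨u₀, hu₀⟩
  · simp
  have hle : ∀ u ∈ A, ∀ v ∈ A, (M.toFinset.filter (fun φ => π φ = u)).card ≤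
      (M.toFinset.filter (fun φ => π φ = v)).card := by
    intro u hu v hv
    obtain ⟨F, h1, h2⟩ := hF u hu v hv
    refine Finset.card_le_card_of_injOn F ?_ ?_
    · intro φ hφ
      simp only [Finset.coe_filter, Set.mem_toFinset, Set.mem_ofPred_eq] at hφ ⊢
      exact h1 φ hφ.1 hφ.2
    · simpa using h2
  rw [Finset.sum_congr rfl (fun u hu => le_antisymm
    (hle u (by simpa using hu) u₀ hu₀) (hle u₀ hu₀ u (by simpa using hu)))]
  simp

end Arithmetic

section Construction

/-- The translation by `(j, c)` of `Fin q × ZMod p`, undefined where it leaves the strip and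
restricted to the zeroth block (if `s`) or to the other blocks (if not `s`). -/
def blockShift (q p : ℕ) (s : Prop) [Decidable s] (j : ℕ) (c : ZMod p) :
    PEquiv (Fin q × ZMod p) (Fin q × ZMod p) where
  toFun x := if h : ((x.1 : ℕ) = 0 ↔ s) ∧ x.1 + j < q then some (⟨x.1 + j, h.2⟩, x.2 + c) else none
  invFun y := if ((y.1 - j : ℕ) = 0 ↔ s) ∧ j ≤ y.1 then
    some (⟨y.1 - j, (Nat.sub_le _ _).trans_lt y.1.2⟩, y.2 - c) else none
  inv := by
    rintro ⟨i, x⟩ ⟨k, y⟩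
    have hk := k.2
    simp only [Option.dite_none_right_eq_some, Option.ite_none_right_eq_some, Option.some.injEq,
      Prod.mk.injEq, Fin.ext_iff]
    constructor
    · rintro ⟨⟨h1, h2⟩, h3, rfl⟩
      refine ⟨⟨?_, by omega⟩, by omega, by ring⟩
      rw [← h3, h1]
    · rintro ⟨⟨h1, h2⟩, h3, rfl⟩
      refine ⟨⟨?_, by omega⟩, by omega, by ring⟩
      rw [← h3, ← h1, Nat.add_sub_cancel]

lemma blockShift_eq_some {q p : ℕ} {s : Prop} [Decidable s] {j : ℕ} {c : ZMod p}
    {x y : Fin q × ZMod p} : blockShift q p s j c x = some y ↔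
      ((x.1 : ℕ) = 0 ↔ s) ∧ (y.1 : ℕ) = x.1 + j ∧ y.2 = x.2 + c := by
  obtain ⟨i, x⟩ := x
  obtain ⟨k, y⟩ := y
  have hk := k.2
  change (if h : ((i : ℕ) = 0 ↔ s) ∧ i + j < q then some ((⟨i + j, h.2⟩ : Fin q), x + c)
    else none) = some (k, y) ↔ _
  simp only [Option.dite_none_right_eq_some, Option.some.injEq, Prod.mk.injEq, Fin.ext_iff]
  constructor
  · rintro ⟨⟨h1, h2⟩, h3, rfl⟩
    exact ⟨h1, h3.symm, rfl⟩
  · rintro ⟨h1, h2, rfl⟩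
    exact ⟨⟨h1, by omega⟩, h2.symm, rfl⟩

/-- Transport of a partial permutation along a bijection with `Fin n`. -/
def transport {n : ℕ} {Y : Type*} (E : Fin n ≃ Y) (φ : PEquiv Y Y) : ISemi n :=
  E.toPEquiv.trans (φ.trans E.symm.toPEquiv)

lemma transport_eq_some {n : ℕ} {Y : Type*} (E : Fin n ≃ Y) (φ : PEquiv Y Y) {u v : Fin n} :
    transport E φ u = some v ↔ φ (E u) = some (E v) := by
  simp only [transport, PEquiv.trans_eq_some, Equiv.toPEquiv_apply, Option.some.injEq]
  constructor
  · rintro ⟨_, rfl, z, hz, rfl⟩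
    simpa using hz
  · intro h
    exact ⟨_, rfl, _, h, by simp⟩

/-- The shifts by fewer than `q` blocks starting at the zeroth block, the shifts by fewer than
`q - 1` blocks defined off the zeroth block, and the empty map. -/
def shiftFamily {n q p : ℕ} (E : Fin n ≃ Fin q × ZMod p) :
    Option ((Fin q × ZMod p) ⊕ (Fin (q - 1) × ZMod p)) → ISemi n
  | none => 0
  | some (Sum.inl (j, c)) => transport E (blockShift q p True j c)
  | some (Sum.inr (j, c)) => transport E (blockShift q p False j c)

lemma shift_mem_range {n q p : ℕ} (E : Fin n ≃ Fin q × ZMod p) (s : Prop) [Decidable s] (j : ℕ)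
    (c : ZMod p) : transport E (blockShift q p s j c) ∈ Set.range (shiftFamily E) := by
  by_cases hs : s
  · by_cases hj : j < q
    · refine ⟨some (Sum.inl (⟨j, hj⟩, c)), ext_some_s2 fun u v => ?_⟩
      simp [shiftFamily, transport_eq_some, blockShift_eq_some, hs]
    · refine ⟨none, ext_some_s2 fun u v => ?_⟩
      have := (E v).1.2
      simp only [shiftFamily, zero_apply, transport_eq_some, blockShift_eq_some, reduceCtorEq,
        false_iff]
      omega
  · by_cases hj : j < q - 1
    · refine ⟨some (Sum.inr (⟨j, hj⟩, c)), ext_some_s2 fun u v => ?_⟩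
      simp [shiftFamily, transport_eq_some, blockShift_eq_some, hs]
    · refine ⟨none, ext_some_s2 fun u v => ?_⟩
      have := (E v).1.2
      simp only [shiftFamily, zero_apply, transport_eq_some, blockShift_eq_some, reduceCtorEq,
        false_iff, hs, iff_false]
      omega

lemma eq_shift_of_mem_range {n q p : ℕ} {E : Fin n ≃ Fin q × ZMod p} {φ : ISemi n}
    (h : φ ∈ Set.range (shiftFamily E)) :
    φ = 0 ∨ ∃ (b : Bool) (j : ℕ) (c : ZMod p), φ = transport E (blockShift q p (b = true) j c) := by
  obtain ⟨_ | ⟨j, c⟩ | ⟨j, c⟩, rfl⟩ := h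
  · exact Or.inl rfl
  · refine Or.inr ⟨true, j, c, ext_some_s2 fun u v => ?_⟩
    simp [shiftFamily, transport_eq_some, blockShift_eq_some]
  · refine Or.inr ⟨false, j, c, ext_some_s2 fun u v => ?_⟩
    simp [shiftFamily, transport_eq_some, blockShift_eq_some]

lemma transport_trans {n : ℕ} {Y : Type*} (E : Fin n ≃ Y) (φ ψ : PEquiv Y Y) :
    (transport E φ).trans (transport E ψ) = transport E (φ.trans ψ) := by
  refine ext_some_s2 fun u v => ?_
  simp only [PEquiv.trans_eq_some, transport_eq_some]
  constructor
  · rintro ⟨w, h1, h2⟩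
    exact ⟨_, h1, h2⟩
  · rintro ⟨w, h1, h2⟩
    exact ⟨E.symm w, by simpa using h1, by simpa using h2⟩

lemma range_shiftFamily_mul {n q p : ℕ} (E : Fin n ≃ Fin q × ZMod p) :
    IsSubsemigroup (Set.range (shiftFamily E)) := by
  intro φ hφ ψ hψ
  have hz : (0 : ISemi n) ∈ Set.range (shiftFamily E) := ⟨none, rfl⟩
  obtain rfl | ⟨b, j, c, rfl⟩ := eq_shift_of_mem_range hφ
  · convert hz using 1
    exact PEquiv.bot_trans _
  obtain rfl | ⟨b', j', c', rfl⟩ := eq_shift_of_mem_range hψ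
  · convert hz using 1
    exact PEquiv.trans_bot _
  rw [transport_trans]
  by_cases hb : b' = true ↔ (b = true ∧ j = 0)
  · convert shift_mem_range E (b = true) (j + j') (c + c') using 1
    refine congrArg _ (PEquiv.ext fun x => Option.ext fun z => ?_)
    rw [PEquiv.trans_eq_some, blockShift_eq_some]
    simp only [blockShift_eq_some]
    constructor
    · rintro ⟨y, ⟨h1, h2, h3⟩, h4, h5, h6⟩
      exact ⟨h1, by omega, by rw [h6, h3, add_assoc]⟩
    · rintro ⟨h1, h2, h3⟩
      have := z.1.2
      refine ⟨(⟨x.1 + j, by omega⟩, x.2 + c), ⟨h1, rfl, rfl⟩, ?_, by simp; omega,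
        by rw [h3, add_assoc]⟩
      rw [hb, ← h1]
      simp
  · convert hz using 1
    refine ext_some_s2 fun u v => ?_
    simp only [transport_eq_some, PEquiv.trans_eq_some, blockShift_eq_some, zero_apply,
      reduceCtorEq, iff_false]
    rintro ⟨y, ⟨h1, h2, h3⟩, h4, h5, h6⟩
    apply hb
    rw [← h4, ← h1, h2]
    omega

lemma exists_small_semitransitive {n p : ℕ} (hn : 2 ≤ n) (hpd : p ∣ n) (hplt : p < n) :
    ∃ S : Set (ISemi n), IsSubsemigroup S ∧ (∀ φ ∈ S, IsSingular φ) ∧ Semitransitive S ∧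
      S.ncard ≤ 2 * n - p + 1 := by
  obtain ⟨q, hq⟩ := hpd
  have hp : p ≠ 0 := by rintro rfl; omega
  have : NeZero p := ⟨hp⟩
  have hq2 : 2 ≤ q := by
    by_contra! h
    interval_cases q <;> omega
  have hcard : Fintype.card (Fin n) = Fintype.card (Fin q × ZMod p) := by
    simp [hq, mul_comm]
  let E : Fin n ≃ Fin q × ZMod p := Fintype.equivOfCardEq hcard
  refine ⟨Set.range (shiftFamily E), range_shiftFamily_mul E, ?_, ?_, ?_⟩
  · intro φ hφ
    obtain rfl | ⟨b, j, c, rfl⟩ := eq_shift_of_mem_range hφ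
    · exact ⟨⟨0, by omega⟩, rfl⟩
    · refine ⟨E.symm (if b then (⟨1, by omega⟩, 0) else (⟨0, by omega⟩, 0)), ?_⟩
      refine Option.eq_none_iff_forall_ne_some.2 fun v hv => ?_
      rw [transport_eq_some, blockShift_eq_some] at hv
      cases b <;> simp at hv
  · have key : ∀ x y : Fin n, (E x).1 ≤ (E y).1 → ∃ φ ∈ Set.range (shiftFamily E), φ x = some y := by
      intro x y hxy
      refine ⟨_, shift_mem_range E ((E x).1.1 = 0) ((E y).1 - (E x).1) ((E y).2 - (E x).2), ?_⟩
      rw [transport_eq_some, blockShift_eq_some]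
      have : (E x).1.1 ≤ (E y).1.1 := hxy
      exact ⟨Iff.rfl, by omega, by ring⟩
    intro x y
    rcases le_total (E x).1 (E y).1 with h | h
    · obtain ⟨φ, hφ, h'⟩ := key x y h
      exact ⟨φ, hφ, Or.inl h'⟩
    · obtain ⟨φ, hφ, h'⟩ := key y x h
      exact ⟨φ, hφ, Or.inr h'⟩
  · rw [← Set.image_univ]
    refine (Set.ncard_image_le Set.finite_univ).trans ?_
    rw [Set.ncard_univ, Nat.card_eq_fintype_card]
    simp only [Fintype.card_option, Fintype.card_sum, Fintype.card_prod, Fintype.card_fin,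
      ZMod.card, Nat.sub_mul, one_mul]
    rw [mul_comm q p, ← hq]
    omega

end Construction

section LeastIdempotents

/-- `c x` is the least idempotent of `S` whose domain contains `x`. -/
structure IsLeastIdem (S : Set (ISemi n)) (c : Fin n → ISemi n) : Prop where
  mem : ∀ x, c x ∈ S
  idem : ∀ x, c x * c x = c x
  self : ∀ x, c x x = some x
  mul_eq : ∀ x, ∀ g ∈ S, g * g = g → g x = some x → c x * g = c x

lemma exists_isLeastIdem (hS : ∀ a ∈ S, ∀ b ∈ S, a * b ∈ S) (hst : Semitransitive S) :
    ∃ c, IsLeastIdem S c := by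
  have : ∀ x, ∃ z ∈ {g | g ∈ S ∧ g * g = g ∧ g x = some x},
      ∀ g ∈ {g | g ∈ S ∧ g * g = g ∧ g x = some x}, z * g = z := by
    intro x
    refine exists_least_idem ?_ (fun g hg => hg.2.1) ?_
    · obtain ⟨φ, hφ, h⟩ := stge_refl hst x
      obtain ⟨k, hk⟩ := exists_pow_idem φ
      exact ⟨_, pow_succ_mem hS hφ k, hk, pow_apply_self h _⟩
    · rintro a ⟨ha, ha', hax⟩ b ⟨hb, hb', hbx⟩
      exact ⟨hS a ha b hb, idem_mul_idem ha' hb', mul_eq_some.2 ⟨x, hax, hbx⟩⟩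
  choose c hc hmin using this
  exact ⟨c, fun x => (hc x).1, fun x => (hc x).2.1, fun x => (hc x).2.2,
    fun x g hg hg' hgx => hmin x g ⟨hg, hg', hgx⟩⟩

/-- `φ` is an element of `S` mapping `x` to `y`, with domain in that of `c x` and image in that
of `c y`. -/
def Typed (S : Set (ISemi n)) (c : Fin n → ISemi n) (φ : ISemi n) (x y : Fin n) : Prop :=
  φ ∈ S ∧ c x * φ = φ ∧ φ * c y = φ ∧ φ x = some y

variable {c : Fin n → ISemi n}

lemma IsLeastIdem.apply_of_eq (hc : IsLeastIdem S c) {x y : Fin n} (h : c x = c y) :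
    c x y = some y := h ▸ hc.self y

lemma IsLeastIdem.eq_of_apply (hc : IsLeastIdem S c) {x y : Fin n} (h1 : c x y = some y)
    (h2 : c y x = some x) : c x = c y := by
  rw [← hc.mul_eq x _ (hc.mem y) (hc.idem y) h2, ← hc.mul_eq y _ (hc.mem x) (hc.idem x) h1,
    idem_comm (hc.idem y) (hc.idem x), ← mul_assoc, hc.idem x]

lemma IsLeastIdem.exists_typed (hc : IsLeastIdem S c) (hS : ∀ a ∈ S, ∀ b ∈ S, a * b ∈ S)
    {x y : Fin n} (h : STGe S x y) : ∃ φ, Typed S c φ x y := by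
  obtain ⟨φ, hφ, h⟩ := h
  refine ⟨c x * φ * c y, hS _ (hS _ (hc.mem x) _ hφ) _ (hc.mem y), ?_, ?_, ?_⟩
  · rw [← mul_assoc, ← mul_assoc, hc.idem]
  · rw [mul_assoc, hc.idem]
  · rw [mul_idem_eq_some (hc.idem y), idem_mul_eq_some (hc.idem x)]
    exact ⟨⟨hc.self x, h⟩, hc.self y⟩

lemma Typed.dom (hc : IsLeastIdem S c) {φ : ISemi n} {x y u v : Fin n} (h : Typed S c φ x y)
    (huv : φ u = some v) : c x u = some u := by
  rw [← h.2.1, idem_mul_eq_some (hc.idem x)] at huv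
  exact huv.1

lemma Typed.im (hc : IsLeastIdem S c) {φ : ISemi n} {x y u v : Fin n} (h : Typed S c φ x y)
    (huv : φ u = some v) : c y v = some v := by
  rw [← h.2.2.1, mul_idem_eq_some (hc.idem y)] at huv
  exact huv.2

lemma Typed.unique (hc : IsLeastIdem S c) {φ : ISemi n} {x y x' y' : Fin n}
    (h : Typed S c φ x y) (h' : Typed S c φ x' y') : c x = c x' ∧ c y = c y' :=
  ⟨hc.eq_of_apply (h.dom hc h'.2.2.2) (h'.dom hc h.2.2.2),
    hc.eq_of_apply (h.im hc h'.2.2.2) (h'.im hc h.2.2.2)⟩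

lemma Typed.ne_zero {φ : ISemi n} {x y : Fin n} (h : Typed S c φ x y) : φ ≠ 0 :=
  ne_zero_of_apply h.2.2.2

end LeastIdempotents

section ThreeCores

variable {c : Fin n → ISemi n}

lemma two_mul_add_one_le_of_three (hS : ∀ a ∈ S, ∀ b ∈ S, a * b ∈ S)
    (hst : Semitransitive S) (hzero : (0 : ISemi n) ∈ S) (hc : IsLeastIdem S c)
    {x₁ x₂ x₃ : Fin n} (h12 : c x₁ ≠ c x₂) (h13 : c x₁ ≠ c x₃) (h23 : c x₂ ≠ c x₃) :
    2 * n + 1 ≤ S.ncard := by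
  classical
  have htop : ∀ k : ISemi n, ∃ t, ∀ y, c y = k → c t = k ∧ STGe S t y := by
    intro k
    rcases ({y | c y = k} : Set (Fin n)).eq_empty_or_nonempty with h | h
    · exact ⟨x₁, fun y hy => absurd hy (Set.eq_empty_iff_forall_notMem.1 h y)⟩
    · obtain ⟨t, ht, hmax⟩ := exists_top hS hst h
      exact ⟨t, fun y hy => ⟨ht, hmax y hy⟩⟩
  choose τ hτ using htop
  have hF : ∀ x, ∃ φ, Typed S c φ (τ (c x)) x := fun x =>
    hc.exists_typed hS (hτ (c x) x rfl).2
  choose F hF using hF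
  let σ : ISemi n → Fin n := fun k => if k = c x₁ then x₂ else if k = c x₂ then x₃ else x₁
  have hσ1 : ∀ k, c (σ k) ≠ k := by
    intro k hk
    simp only [σ] at hk
    split_ifs at hk with h1 h2
    · exact h12 (h1 ▸ hk.symm)
    · exact h23 (h2 ▸ hk.symm)
    · exact h1 hk.symm
  have hσ2 : ∀ k, c (σ (c (σ k))) ≠ k := by
    intro k hk
    by_cases h1 : k = c x₁
    · simp [σ, h1, h12.symm] at hk
      exact h13 hk.symm
    by_cases h2 : k = c x₂
    · simp [σ, h2, h12.symm, h13.symm, h23.symm] at hk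
      exact h12 hk
    · simp [σ, h1, h2] at hk
      exact h2 hk.symm
  have hG : ∀ x, ∃ φ, Typed S c φ x (σ (c x)) ∨ Typed S c φ (σ (c x)) x := by
    intro x
    rcases stge_total hst x (σ (c x)) with h | h
    · obtain ⟨φ, hφ⟩ := hc.exists_typed hS h
      exact ⟨φ, Or.inl hφ⟩
    · obtain ⟨φ, hφ⟩ := hc.exists_typed hS h
      exact ⟨φ, Or.inr hφ⟩
  choose G hG using hG
  have hinj : Function.Injective (Sum.elim F G) := by
    refine Function.Injective.sumElim ?_ ?_ ?_
    · intro x y hxy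
      have h1 := hF x
      have h2 := hF y
      rw [← hxy] at h2
      have h3 := h1.2.2.2
      rw [(h1.unique hc h2).2, h2.2.2.2] at h3
      simpa using h3.symm
    · intro x y hxy
      have h1 := hG x
      have h2 := hG y
      rw [← hxy] at h2
      rcases h1 with h1 | h1 <;> rcases h2 with h2 | h2 <;> obtain ⟨h3, h4⟩ := h1.unique hc h2
      · have h5 := h1.2.2.2
        rw [h3] at h5
        exact apply_inj h5 h2.2.2.2
      · exact absurd h3.symm (h4 ▸ hσ2 (c x))
      · exact absurd h4.symm (h3 ▸ hσ2 (c x))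
      · have h5 := h1.2.2.2
        rw [h4, h2.2.2.2] at h5
        simpa using h5.symm
    · intro x y hxy
      have h1 := hF x
      rw [hxy] at h1
      have h0 := (hτ (c x) x rfl).1
      rcases hG y with h2 | h2 <;> obtain ⟨h3, h4⟩ := h1.unique hc h2
      · exact hσ1 (c y) (by rw [← h4, ← h0, h3])
      · exact hσ1 (c y) (by rw [← h3, h0, h4])
  have hsub : insert 0 (Set.range (Sum.elim F G)) ⊆ S := by
    rintro φ (rfl | ⟨x | x, rfl⟩)
    · exact hzero
    · exact (hF x).1
    · exact (hG x).elim (fun h => h.1) (fun h => h.1)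
  have h0 : (0 : ISemi n) ∉ Set.range (Sum.elim F G) := by
    rintro ⟨x | x, h⟩
    · exact (hF x).ne_zero h
    · exact (hG x).elim (fun h' => h'.ne_zero h) (fun h' => h'.ne_zero h)
  refine le_trans ?_ (Set.ncard_le_ncard hsub)
  rw [Set.ncard_insert_of_notMem h0, ← Set.image_univ, Set.ncard_image_of_injective _ hinj,
    Set.ncard_univ, Nat.card_eq_fintype_card]
  simp
  omega

end ThreeCores

section TwoCores

variable {c : Fin n → ISemi n} {x y : Fin n}

/-- There are two least idempotents `c x` and `c y`, with complementary domains, where `x` is a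
maximum of the preorder induced by `S` and `y` a maximum on the domain of `c y`. -/
structure TwoCores (S : Set (ISemi n)) (c : Fin n → ISemi n) (x y : Fin n) : Prop
    extends IsLeastIdem S c where
  mul_mem : ∀ a ∈ S, ∀ b ∈ S, a * b ∈ S
  semitransitive : Semitransitive S
  zero_mem : (0 : ISemi n) ∈ S
  ne : c x ≠ c y
  eq_or_eq : ∀ u, c u = c x ∨ c u = c y
  top : ∀ u, STGe S x u
  top_snd : ∀ u, c u = c y → STGe S y u
  dom : ∀ u v, c u v = some v → c u = c v
  prim : ∀ u, ∀ g ∈ S, g * g = g → g * c u = g → g ≠ 0 → g = c u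

lemma exists_twoCores (hS : ∀ a ∈ S, ∀ b ∈ S, a * b ∈ S) (hsing : ∀ φ ∈ S, IsSingular φ)
    (hst : Semitransitive S) (hzero : (0 : ISemi n) ∈ S) (hn : 0 < n) (hc : IsLeastIdem S c)
    (hthree : ∀ u v w, c u = c v ∨ c u = c w ∨ c v = c w) : ∃ x y, TwoCores S c x y := by
  obtain ⟨x, -, hx⟩ := exists_top hS hst (T := Set.univ) ⟨⟨0, hn⟩, trivial⟩
  have hy : ∃ y, c x ≠ c y := by
    by_contra! h
    obtain ⟨w, hw⟩ := hsing _ (hc.mem x)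
    simp [hc.apply_of_eq (h w)] at hw
  obtain ⟨y', hy'⟩ := hy
  obtain ⟨y, hy, hytop⟩ := exists_top hS hst (T := {u | c u = c y'}) ⟨y', rfl⟩
  have hy : c y = c y' := hy
  have hdom : ∀ u v, c u v = some v → c u = c v := by
    intro u v huv
    by_contra hne
    obtain ⟨w, hw⟩ := hsing _ (hc.mem u)
    rcases hthree u v w with h | h | h
    · exact hne h
    · simp [hc.apply_of_eq h] at hw
    · have h1 := hc.mul_eq v _ (hc.mem u) (hc.idem u) huv
      have h2 := hc.self w
      rw [← h, ← h1, mul_idem_eq_some (hc.idem u)] at h2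
      simp [h2.2] at hw
  refine ⟨x, y, hc, hS, hst, hzero, hy ▸ hy', fun u => ?_, fun u => hx u trivial,
    fun u hu => hytop u (hu.trans hy), hdom, ?_⟩
  · rcases hthree u x y with h | h | h
    · exact Or.inl h
    · exact Or.inr h
    · exact absurd (h.trans hy) hy'
  · intro u g hg hgg hgu hg0
    obtain ⟨v, w, hvw⟩ := exists_apply_of_ne_zero hg0
    have hv := apply_self_of_idem hgg hvw
    have huv := hv
    rw [← hgu, mul_idem_eq_some (hc.idem u)] at huv
    rw [hdom u v huv.2, ← hc.mul_eq v g hg hgg hv, ← idem_comm hgg (hc.idem v),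
      ← hdom u v huv.2, hgu]

/-- The points of the same core as `v` that are mutually reachable with `v`. -/
def coreClass (S : Set (ISemi n)) (c : Fin n → ISemi n) (v : Fin n) : Set (Fin n) :=
  {w | c w = c v ∧ STGe S v w ∧ STGe S w v}

namespace TwoCores

lemma refl (T : TwoCores S c x y) (v : Fin n) : v ∈ coreClass S c v :=
  ⟨rfl, stge_refl T.semitransitive v, stge_refl T.semitransitive v⟩

lemma trans (T : TwoCores S c x y) {u v w : Fin n} (h1 : STGe S u v) (h2 : STGe S v w) :
    STGe S u w := stge_trans T.mul_mem h1 h2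

lemma coreClass_eq (T : TwoCores S c x y) {v w : Fin n} (h : w ∈ coreClass S c v) :
    coreClass S c w = coreClass S c v := by
  obtain ⟨h1, h2, h3⟩ := h
  ext u
  constructor
  · rintro ⟨h4, h5, h6⟩
    exact ⟨h4.trans h1, T.trans h2 h5, T.trans h6 h3⟩
  · rintro ⟨h4, h5, h6⟩
    exact ⟨h4.trans h1.symm, T.trans h3 h5, T.trans h6 h2⟩

lemma localUnit (T : TwoCores S c x y) {v : Fin n} {a b : ISemi n} (ha : a ∈ S) (hb : b ∈ S)
    (hea : c v * a = a) (hae : a * c v = a) (heb : c v * b = b) (hbe : b * c v = b)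
    (hpow : ∀ k, (a * b) ^ k ≠ 0) : LocalUnit S (c v) a ∧ LocalUnit S (c v) b :=
  localUnit_of_pow_ne_zero T.mul_mem (T.idem v) (T.prim v) ha hb hea hae heb hbe hpow

lemma exists_localUnit (T : TwoCores S c x y) {v w w' : Fin n} (hw : w ∈ coreClass S c v)
    (hw' : w' ∈ coreClass S c v) : ∃ g, LocalUnit S (c v) g ∧ g w = some w' := by
  obtain ⟨g, hg, h1, h2, h3⟩ := T.exists_typed T.mul_mem (T.trans hw.2.2 hw'.2.1)
  obtain ⟨b, hb, h4, h5, h6⟩ := T.exists_typed T.mul_mem (T.trans hw'.2.2 hw.2.1)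
  rw [hw.1] at h1 h5
  rw [hw'.1] at h2 h4
  refine ⟨g, (T.localUnit hg hb h1 h2 h4 h5 fun k => ?_).1, h3⟩
  exact ne_zero_of_apply (pow_apply_self (mul_eq_some.2 ⟨w', h3, h6⟩) k)

lemma localUnit_rel (T : TwoCores S c x y) {v u u' : Fin n} {g : ISemi n}
    (hg : LocalUnit S (c v) g) (h : g u = some u') :
    c u = c v ∧ c u' = c v ∧ STGe S u u' ∧ STGe S u' u := by
  have hu : c v u = some u := by
    have h' := h
    rw [← hg.2.1, idem_mul_eq_some (T.idem v)] at h'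
    exact h'.1
  obtain ⟨w, h1, h2, h3, h4⟩ := hg.exists_apply hu
  obtain rfl : w = u' := by simpa [h] using h1.symm
  exact ⟨(T.dom _ _ hu).symm, (T.dom _ _ h4).symm, h2, h3⟩

lemma mem_coreClass_iff (T : TwoCores S c x y) {v u u' z : Fin n} {g : ISemi n}
    (hg : LocalUnit S (c v) g) (h : g u = some u') :
    u ∈ coreClass S c z ↔ u' ∈ coreClass S c z := by
  obtain ⟨h1, h2, h3, h4⟩ := T.localUnit_rel hg h
  constructor
  · rintro ⟨h5, h6, h7⟩
    exact ⟨h2.trans (h1.symm.trans h5), T.trans h6 h3, T.trans h4 h7⟩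
  · rintro ⟨h5, h6, h7⟩
    exact ⟨h1.trans (h2.symm.trans h5), T.trans h6 h4, T.trans h3 h7⟩

end TwoCores

/-- The elements of `c x * S * c v` mapping some point of the class of `x` into the class of `v`,
none to a point strictly above `v`, and no other point into the class of `y`. -/
def rowSet (S : Set (ISemi n)) (c : Fin n → ISemi n) (x y v : Fin n) : Set (ISemi n) :=
  {φ | φ ∈ S ∧ c x * φ = φ ∧ φ * c v = φ ∧
    (∃ u ∈ coreClass S c x, ∃ w ∈ coreClass S c v, φ u = some w) ∧
    (∀ u ∈ coreClass S c x, ∀ w, φ u = some w → STGe S v w) ∧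
    ∀ u, u ∉ coreClass S c x → ∀ w ∈ coreClass S c y, φ u ≠ some w}

namespace TwoCores

lemma unit_mul_mem_rowSet (T : TwoCores S c x y) {v : Fin n} {g φ : ISemi n}
    (hg : LocalUnit S (c x) g) (hφ : φ ∈ rowSet S c x y v) : g * φ ∈ rowSet S c x y v := by
  obtain ⟨h1, h2, h3, ⟨u, hu, w, hw, huw⟩, h5, h6⟩ := hφ
  refine ⟨T.mul_mem _ hg.1 _ h1, by rw [← mul_assoc, hg.2.1], by rw [mul_assoc, h3], ?_, ?_, ?_⟩
  · obtain ⟨b, hb, -, hbg⟩ := hg.symm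
    have hx := T.apply_of_eq hu.1.symm
    rw [← hbg, mul_eq_some] at hx
    obtain ⟨u', hu', hgu⟩ := hx
    exact ⟨u', (T.mem_coreClass_iff hg hgu).2 hu, w, hw, mul_eq_some.2 ⟨u, hgu, huw⟩⟩
  · intro u hu w huw
    obtain ⟨u', hu', hw⟩ := mul_eq_some.1 huw
    exact h5 u' ((T.mem_coreClass_iff hg hu').1 hu) w hw
  · intro u hu w hw huw
    obtain ⟨u', hu', hw'⟩ := mul_eq_some.1 huw
    exact h6 u' (fun h => hu ((T.mem_coreClass_iff hg hu').2 h)) w hw hw'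

lemma mul_unit_mem_rowSet (T : TwoCores S c x y) {v : Fin n} {g φ : ISemi n}
    (hg : LocalUnit S (c v) g) (hφ : φ ∈ rowSet S c x y v) : φ * g ∈ rowSet S c x y v := by
  obtain ⟨h1, h2, h3, ⟨u, hu, w, hw, huw⟩, h5, h6⟩ := hφ
  refine ⟨T.mul_mem _ h1 _ hg.1, by rw [← mul_assoc, h2], by rw [mul_assoc, hg.2.2.1], ?_, ?_, ?_⟩
  · obtain ⟨w', hw', -⟩ := hg.exists_apply (T.apply_of_eq hw.1.symm)
    exact ⟨u, hu, w', (T.mem_coreClass_iff hg hw').1 hw, mul_eq_some.2 ⟨w, huw, hw'⟩⟩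
  · intro u hu w huw
    obtain ⟨w', hw', hw⟩ := mul_eq_some.1 huw
    exact T.trans (h5 u hu w' hw') (T.localUnit_rel hg hw).2.2.1
  · intro u hu w hw huw
    obtain ⟨w', hw', hw''⟩ := mul_eq_some.1 huw
    exact h6 u hu w' ((T.mem_coreClass_iff hg hw'').2 hw) hw'

lemma exists_apply_unit_mul_iff (T : TwoCores S c x y) {g : ISemi n}
    (hg : LocalUnit S (c x) g) (φ : ISemi n) (w : Fin n) :
    (∃ u ∈ coreClass S c x, (g * φ) u = some w) ↔ ∃ u ∈ coreClass S c x, φ u = some w := by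
  constructor
  · rintro ⟨u, hu, h⟩
    obtain ⟨u', hu', h'⟩ := mul_eq_some.1 h
    exact ⟨u', (T.mem_coreClass_iff hg hu').1 hu, h'⟩
  · rintro ⟨u, hu, h⟩
    obtain ⟨b, hb, -, hbg⟩ := hg.symm
    have hx := T.apply_of_eq hu.1.symm
    rw [← hbg, mul_eq_some] at hx
    obtain ⟨u', hu', hgu⟩ := hx
    exact ⟨u', (T.mem_coreClass_iff hg hgu).2 hu, mul_eq_some.2 ⟨u, hgu, h⟩⟩

lemma exists_apply_mul_unit_iff (T : TwoCores S c x y) {v : Fin n} {g : ISemi n}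
    (hg : LocalUnit S (c v) g) (φ : ISemi n) (u : Fin n) :
    (∃ w ∈ coreClass S c v, (φ * g) u = some w) ↔ ∃ w ∈ coreClass S c v, φ u = some w := by
  constructor
  · rintro ⟨w, hw, h⟩
    obtain ⟨w', hw', h'⟩ := mul_eq_some.1 h
    exact ⟨w', (T.mem_coreClass_iff hg h').2 hw, hw'⟩
  · rintro ⟨w, hw, h⟩
    obtain ⟨w', hw', -⟩ := hg.exists_apply (T.apply_of_eq hw.1.symm)
    exact ⟨w', (T.mem_coreClass_iff hg hw').1 hw, mul_eq_some.2 ⟨w, h, hw'⟩⟩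

lemma ncard_dvd_rowSet_left (T : TwoCores S c x y) (v : Fin n) :
    (coreClass S c x).ncard ∣ (rowSet S c x y v).ncard := by
  have : Nonempty (Fin n) := ⟨x⟩
  let val : ISemi n → Fin n := fun φ => Classical.epsilon
    fun w => w ∈ coreClass S c v ∧ ∃ u ∈ coreClass S c x, φ u = some w
  let π : ISemi n → Fin n := fun φ => Classical.epsilon
    fun u => u ∈ coreClass S c x ∧ φ u = some (val φ)
  have hval : ∀ φ ∈ rowSet S c x y v, ∃ u ∈ coreClass S c x, φ u = some (val φ) := by
    rintro φ ⟨-, -, -, ⟨u, hu, w, hw, huw⟩, -⟩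
    exact (Classical.epsilon_spec (p := fun w => w ∈ coreClass S c v ∧
      ∃ u ∈ coreClass S c x, φ u = some w) ⟨w, hw, u, hu, huw⟩).2
  have hπ : ∀ φ ∈ rowSet S c x y v, π φ ∈ coreClass S c x ∧ φ (π φ) = some (val φ) :=
    fun φ hφ => Classical.epsilon_spec (hval φ hφ)
  refine ncard_dvd_ncard_of_fiber_embed π (fun φ hφ => (hπ φ hφ).1) fun u hu u' hu' => ?_
  obtain ⟨g, hg, hgu⟩ := T.exists_localUnit hu' hu
  refine ⟨fun φ => g * φ, ?_, ?_⟩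
  · rintro φ hφ rfl
    have hmem := T.unit_mul_mem_rowSet hg hφ
    refine ⟨hmem, ?_⟩
    have hv : val (g * φ) = val φ := by
      simp only [val, T.exists_apply_unit_mul_iff hg]
    have h1 := (hπ _ hmem).2
    rw [hv] at h1
    exact apply_inj h1 (mul_eq_some.2 ⟨_, hgu, (hπ φ hφ).2⟩)
  · rintro φ ⟨hφ, -⟩ ψ ⟨hψ, -⟩ h
    obtain ⟨b, -, -, hbg⟩ := hg.symm
    have h' : b * (g * φ) = b * (g * ψ) := congrArg (b * ·) h
    rwa [← mul_assoc, ← mul_assoc, hbg, hφ.2.1, hψ.2.1] at h'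

lemma ncard_dvd_rowSet_right (T : TwoCores S c x y) (v : Fin n) :
    (coreClass S c v).ncard ∣ (rowSet S c x y v).ncard := by
  have : Nonempty (Fin n) := ⟨x⟩
  let src : ISemi n → Fin n := fun φ => Classical.epsilon
    fun u => u ∈ coreClass S c x ∧ ∃ w ∈ coreClass S c v, φ u = some w
  let π : ISemi n → Fin n := fun φ => Classical.epsilon
    fun w => w ∈ coreClass S c v ∧ φ (src φ) = some w
  have hsrc : ∀ φ ∈ rowSet S c x y v, ∃ w ∈ coreClass S c v, φ (src φ) = some w := by
    rintro φ ⟨-, -, -, ⟨u, hu, w, hw, huw⟩, -⟩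
    exact (Classical.epsilon_spec (p := fun u => u ∈ coreClass S c x ∧
      ∃ w ∈ coreClass S c v, φ u = some w) ⟨u, hu, w, hw, huw⟩).2
  have hπ : ∀ φ ∈ rowSet S c x y v, π φ ∈ coreClass S c v ∧ φ (src φ) = some (π φ) :=
    fun φ hφ => Classical.epsilon_spec (hsrc φ hφ)
  refine ncard_dvd_ncard_of_fiber_embed π (fun φ hφ => (hπ φ hφ).1) fun w hw w' hw' => ?_
  obtain ⟨g, hg, hgw⟩ := T.exists_localUnit hw hw'
  refine ⟨fun φ => φ * g, ?_, ?_⟩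
  · rintro φ hφ rfl
    have hmem := T.mul_unit_mem_rowSet hg hφ
    refine ⟨hmem, ?_⟩
    have hv : src (φ * g) = src φ := by
      simp only [src, T.exists_apply_mul_unit_iff hg]
    have h1 := (hπ _ hmem).2
    rw [hv, mul_eq_some.2 ⟨_, (hπ φ hφ).2, hgw⟩] at h1
    simpa using h1.symm
  · rintro φ ⟨hφ, -⟩ ψ ⟨hψ, -⟩ h
    obtain ⟨b, -, hgb, -⟩ := hg.symm
    have h' : (φ * g) * b = (ψ * g) * b := congrArg (· * b) h
    rwa [mul_assoc, mul_assoc, hgb, hφ.2.2.1, hψ.2.2.1] at h'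

lemma pow_mul_mul_pow {M : Type*} [Monoid M] {τ φ ρ : M} (h : τ * φ * ρ = φ) (k : ℕ) :
    τ ^ k * φ * ρ ^ k = φ := by
  induction k with
  | zero => simp
  | succ k ih =>
    calc τ ^ (k + 1) * φ * ρ ^ (k + 1) = τ ^ k * (τ * φ * ρ) * ρ ^ k := by
          rw [pow_succ, pow_succ']; simp only [mul_assoc]
      _ = φ := by rw [h, ih]

/-- Some element mapping `x` to `v` is minimal, in the sense that its multiples in the local
monoids that still map `x` to `v` arise through invertible factors only. -/
lemma exists_minimal_typed (T : TwoCores S c x y) (v : Fin n) :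
    ∃ φ, Typed S c φ x v ∧ ∀ α ∈ S, ∀ β ∈ S, c x * α = α → α * c x = α → c v * β = β →
      β * c v = β → (α * φ * β) x = some v → LocalUnit S (c x) α ∧ LocalUnit S (c v) β := by
  let J : ISemi n → Set (ISemi n) := fun φ => {ψ | ∃ γ ∈ S, ∃ δ ∈ S, ψ = γ * φ * δ}
  obtain ⟨φ, hφ, hmin⟩ := Set.exists_min_image {φ | Typed S c φ x v} (fun φ => (J φ).ncard)
    (Set.toFinite _) (T.exists_typed T.mul_mem (T.top v))
  have hφ : Typed S c φ x v := hφ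
  refine ⟨φ, hφ, fun α hα β hβ hxα hαx hvβ hβv h => ?_⟩
  have hmem : α * φ * β ∈ S := T.mul_mem _ (T.mul_mem _ hα _ hφ.1) _ hβ
  have hle := hmin (α * φ * β) ⟨hmem, by rw [← mul_assoc, ← mul_assoc, hxα],
    by rw [mul_assoc, hβv], h⟩
  have hsub : J (α * φ * β) ⊆ J φ := by
    rintro _ ⟨γ, hγ, δ, hδ, rfl⟩
    exact ⟨γ * α, T.mul_mem _ hγ _ hα, β * δ, T.mul_mem _ hβ _ hδ, by simp only [mul_assoc]⟩
  have hJ := Set.eq_of_subset_of_ncard_le hsub hle (Set.toFinite _)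
  have hφJ : φ ∈ J (α * φ * β) := by
    rw [hJ]
    exact ⟨c x, T.mem x, c v, T.mem v, by rw [hφ.2.1, hφ.2.2.1]⟩
  obtain ⟨γ, hγ, δ, hδ, hγδ⟩ := hφJ
  have h1 : (c x * γ * c x * α) * φ * (β * (c v * δ * c v)) = φ := by
    calc (c x * γ * c x * α) * φ * (β * (c v * δ * c v))
        = c x * (γ * ((c x * α) * φ * (β * c v)) * δ) * c v := by simp only [mul_assoc]
      _ = φ := by rw [hxα, hβv, ← hγδ, hφ.2.1, hφ.2.2.1]
  have h0 := hφ.ne_zero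
  constructor
  · refine (T.localUnit (v := x) (a := c x * γ * c x) (b := α)
      (T.mul_mem _ (T.mul_mem _ (T.mem x) _ hγ) _ (T.mem x)) hα ?_ ?_ hxα hαx fun k hk => h0 ?_).2
    · simp only [← mul_assoc, T.idem]
    · simp only [mul_assoc, T.idem]
    · rw [← pow_mul_mul_pow h1 k, hk, zero_mul, zero_mul]
  · refine (T.localUnit (v := v) (a := β) (b := c v * δ * c v) hβ
      (T.mul_mem _ (T.mul_mem _ (T.mem v) _ hδ) _ (T.mem v)) hvβ hβv ?_ ?_ fun k hk => h0 ?_).1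
    · simp only [← mul_assoc, T.idem]
    · simp only [mul_assoc, T.idem]
    · rw [← pow_mul_mul_pow h1 k, hk, mul_zero]

lemma rowSet_nonempty (T : TwoCores S c x y) (v : Fin n) : (rowSet S c x y v).Nonempty := by
  obtain ⟨φ, hφ, hmin⟩ := T.exists_minimal_typed v
  have typed_of : ∀ {u w}, STGe S u w → c u = c w →
      ∃ α ∈ S, c u * α = α ∧ α * c u = α ∧ α u = some w := by
    intro u w h huw
    obtain ⟨α, h1, h2, h3, h4⟩ := T.exists_typed T.mul_mem h
    exact ⟨α, h1, h2, huw ▸ h3, h4⟩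
  refine ⟨φ, hφ.1, hφ.2.1, hφ.2.2.1, ⟨x, T.refl x, v, T.refl v, hφ.2.2.2⟩, ?_, ?_⟩
  · intro u hu w huw
    rcases stge_total T.semitransitive v w with h | h
    · exact h
    have hcw : c v = c w := T.dom _ _ (hφ.im T.toIsLeastIdem huw)
    obtain ⟨α, h1, h2, h3, h4⟩ := typed_of (T.top u) hu.1.symm
    obtain ⟨β, h5, h6, h7, h8⟩ := typed_of h hcw.symm
    rw [← hcw] at h6 h7
    have := hmin α h1 β h5 h2 h3 h6 h7 (mul_eq_some.2 ⟨w, mul_eq_some.2 ⟨u, h4, huw⟩, h8⟩)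
    exact (T.localUnit_rel this.2 h8).2.2.2
  · intro u hu w hw huw
    have hcw : c v = c w := T.dom _ _ (hφ.im T.toIsLeastIdem huw)
    have hcu : c x = c u := T.dom _ _ (hφ.dom T.toIsLeastIdem huw)
    obtain ⟨α, h1, h2, h3, h4⟩ := typed_of (T.top u) hcu
    obtain ⟨β, h5, h6, h7, h8⟩ :=
      typed_of (T.trans hw.2.2 (T.top_snd v (hcw.trans hw.1))) hcw.symm
    rw [← hcw] at h6 h7
    have := hmin α h1 β h5 h2 h3 h6 h7 (mul_eq_some.2 ⟨w, mul_eq_some.2 ⟨u, h4, huw⟩, h8⟩)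
    obtain ⟨h9, h10, h11, h12⟩ := T.localUnit_rel this.1 h4
    exact hu ⟨h10, h11, h12⟩

lemma coreClass_eq_of_mem_rowSet (T : TwoCores S c x y) {v v' : Fin n} {φ : ISemi n}
    (h : φ ∈ rowSet S c x y v) (h' : φ ∈ rowSet S c x y v') :
    coreClass S c v = coreClass S c v' := by
  obtain ⟨-, -, h1, ⟨u, hu, w, hw, huw⟩, h2, -⟩ := h
  obtain ⟨-, -, h1', ⟨u', hu', w', hw', huw'⟩, h2', -⟩ := h'
  have h3 := huw
  rw [← h1', mul_idem_eq_some (T.idem v')] at h3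
  have h4 := T.dom _ _ h3.2
  refine T.coreClass_eq ⟨hw.1.symm.trans h4.symm, T.trans (h2' u hu w huw) hw.2.2,
    T.trans (h2 u' hu' w' huw') hw'.2.2⟩

lemma exists_col (T : TwoCores S c x y) : ∃ H : Fin n → ISemi n,
    (∀ u, u ∉ coreClass S c x → H u ∈ S ∧ H u ≠ 0 ∧ ∀ v, H u ∉ rowSet S c x y v) ∧
    Set.InjOn H (coreClass S c x)ᶜ := by
  have hH : ∀ u, ∃ φ, Typed S c φ y u ∨ (c u = c x ∧ Typed S c φ u y) := by
    intro u
    rcases stge_total T.semitransitive y u with h | h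
    · obtain ⟨φ, hφ⟩ := T.exists_typed T.mul_mem h
      exact ⟨φ, Or.inl hφ⟩
    · rcases T.eq_or_eq u with hu | hu
      · obtain ⟨φ, hφ⟩ := T.exists_typed T.mul_mem h
        exact ⟨φ, Or.inr ⟨hu, hφ⟩⟩
      · obtain ⟨φ, hφ⟩ := T.exists_typed T.mul_mem (T.top_snd u hu)
        exact ⟨φ, Or.inl hφ⟩
  choose H hH using hH
  refine ⟨H, fun u hu => ⟨?_, ?_, fun v hv => ?_⟩, ?_⟩
  · exact (hH u).elim (fun h => h.1) (fun h => h.2.1)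
  · exact (hH u).elim (fun h => h.ne_zero) (fun h => h.2.ne_zero)
  · rcases hH u with h | ⟨-, h⟩
    · have h1 := h.2.2.2
      rw [← hv.2.1, idem_mul_eq_some (T.idem x)] at h1
      exact T.ne (T.dom _ _ h1.1)
    · exact hv.2.2.2.2.2 u hu y (T.refl y) h.2.2.2
  · intro u hu u' hu' heq
    have h1 := hH u
    have h2 := hH u'
    rw [← heq] at h2
    rcases h1 with h1 | ⟨h0, h1⟩ <;> rcases h2 with h2 | ⟨h0', h2⟩
    · simpa [h1.2.2.2] using h2.2.2.2
    · exact absurd (h0'.symm.trans (h1.unique T.toIsLeastIdem h2).1.symm) T.ne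
    · exact absurd (h0.symm.trans (h1.unique T.toIsLeastIdem h2).1) T.ne
    · exact apply_inj h1.2.2.2 h2.2.2.2

lemma le_ncard (T : TwoCores S c x y) {p : ℕ} (hpmax : ∀ d : ℕ, d ∣ n → d < n → d ≤ p) :
    2 * n + 1 ≤ S.ncard + p := by
  classical
  have : Nonempty (Fin n) := ⟨x⟩
  let r : Fin n → Fin n := fun v => Classical.epsilon fun w => w ∈ coreClass S c v
  have hr : ∀ v, r v ∈ coreClass S c v := fun v => Classical.epsilon_spec ⟨v, T.refl v⟩
  have hr_eq : ∀ v w, coreClass S c v = coreClass S c w → r v = r w := fun v w h => by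
    simp only [r, h]
  let s : Finset (Fin n) := Finset.univ.image r
  have hrr : ∀ i ∈ s, r i = i := by
    intro i hi
    obtain ⟨v, -, rfl⟩ := Finset.mem_image.1 hi
    exact hr_eq _ _ (T.coreClass_eq (hr v))
  have hpos : ∀ v, 0 < (coreClass S c v).ncard := fun v =>
    (Set.ncard_pos (Set.toFinite _)).2 ⟨v, T.refl v⟩
  have hsum : ∑ i ∈ s, (coreClass S c i).ncard = n := by
    have h1 := Finset.card_eq_sum_card_fiberwise (f := r) (s := Finset.univ) (t := s)
      (fun v _ => Finset.mem_coe.2 (Finset.mem_image_of_mem r (Finset.mem_univ v)))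
    rw [Finset.card_univ, Fintype.card_fin] at h1
    refine Eq.trans (Finset.sum_congr rfl fun i hi => ?_) h1.symm
    rw [← Set.ncard_coe_finset]
    congr 1
    ext v
    simp only [Finset.coe_filter, Finset.mem_univ, true_and, Set.mem_ofPred_eq]
    constructor
    · intro hv
      rw [hr_eq _ _ (T.coreClass_eq hv), hrr i hi]
    · intro hv
      rw [T.coreClass_eq (v := v) (hv ▸ hr v)]
      exact T.refl v
  have hlt : (coreClass S c x).ncard < n := by
    have h1 : coreClass S c x ⊂ Set.univ :=
      Set.ssubset_univ_iff.2 fun h => T.ne ((h ▸ Set.mem_univ y : y ∈ coreClass S c x).1).symm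
    simpa using Set.ncard_lt_ncard h1
  have harith := add_le_sum_add s (fun i => (coreClass S c i).ncard)
    (fun i => (rowSet S c x y i).ncard) (hpos x) hlt hpmax hsum (fun i _ => hpos i)
    (fun i _ => (Set.ncard_pos (Set.toFinite _)).2 (T.rowSet_nonempty i))
    (fun i _ => T.ncard_dvd_rowSet_left i) (fun i _ => T.ncard_dvd_rowSet_right i)
  let row : Finset (ISemi n) := s.biUnion fun i => (Set.toFinite (rowSet S c x y i)).toFinset
  have mem_row : ∀ φ, φ ∈ row ↔ ∃ i ∈ s, φ ∈ rowSet S c x y i := by simp [row]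
  have hrow : row.card = ∑ i ∈ s, (rowSet S c x y i).ncard := by
    rw [Finset.card_biUnion]
    · exact Finset.sum_congr rfl fun i _ => (Set.ncard_eq_toFinset_card _ _).symm
    · intro i hi j hj hij
      refine Finset.disjoint_left.2 fun φ hφ hφ' => hij ?_
      rw [Set.Finite.mem_toFinset] at hφ hφ'
      rw [← hrr i hi, ← hrr j hj]
      exact hr_eq _ _ (T.coreClass_eq_of_mem_rowSet hφ hφ')
  obtain ⟨H, hH, hinj⟩ := T.exists_col
  have hcol : (H '' (coreClass S c x)ᶜ).ncard + (coreClass S c x).ncard = n := by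
    rw [hinj.ncard_image, add_comm, Set.ncard_add_ncard_compl, Nat.card_fin]
  have hdisj : Disjoint (row : Set (ISemi n)) (H '' (coreClass S c x)ᶜ) := by
    refine Set.disjoint_left.2 ?_
    rintro _ hφ ⟨u, hu, rfl⟩
    obtain ⟨i, -, hi⟩ := (mem_row _).1 hφ
    exact (hH u hu).2.2 i hi
  have hunion := Set.ncard_union_eq hdisj (Set.toFinite _) (Set.toFinite _)
  have hzero : (0 : ISemi n) ∉ (row : Set (ISemi n)) ∪ H '' (coreClass S c x)ᶜ := by
    rintro (h | ⟨u, hu, h⟩)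
    · obtain ⟨i, -, -, -, -, ⟨u, -, w, -, huw⟩, -⟩ := (mem_row _).1 h
      exact ne_zero_of_apply huw rfl
    · exact (hH u hu).2.1 h
  have hsub : insert 0 ((row : Set (ISemi n)) ∪ H '' (coreClass S c x)ᶜ) ⊆ S := by
    rintro φ (rfl | h | ⟨u, hu, rfl⟩)
    · exact T.zero_mem
    · obtain ⟨i, -, hi⟩ := (mem_row _).1 h
      exact hi.1
    · exact (hH u hu).1
  have hle := Set.ncard_le_ncard hsub (Set.toFinite _)
  rw [Set.ncard_insert_of_notMem hzero (Set.toFinite _), hunion, Set.ncard_coe_finset, hrow] at hle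
  omega

end TwoCores

end TwoCores


lemma le_ncard_of_semitransitive {p : ℕ} (hn : 0 < n)
    (hpmax : ∀ d : ℕ, d ∣ n → d < n → d ≤ p) (hS : ∀ a ∈ S, ∀ b ∈ S, a * b ∈ S)
    (hsing : ∀ φ ∈ S, IsSingular φ) (hst : Semitransitive S) : 2 * n + 1 ≤ S.ncard + p := by
  have hzero := zero_mem hS hsing hst hn
  obtain ⟨c, hc⟩ := exists_isLeastIdem hS hst
  by_cases h : ∀ u v w, c u = c v ∨ c u = c w ∨ c v = c w
  · obtain ⟨x, y, T⟩ := exists_twoCores hS hsing hst hzero hn hc h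
    exact T.le_ncard hpmax
  · push Not at h
    obtain ⟨u, v, w, h12, h13, h23⟩ := h
    have := two_mul_add_one_le_of_three hS hst hzero hc h12 h13 h23
    omega

end ISemi

/-- if `p` is the greatest proper divisor of `n ≥ 2`, then `2n - p + 1`
is the least cardinality of a semitransitive subsemigroup of the singular part
`I_n \ S_n`: it is attained, and no smaller cardinality occurs. -/
theorem stmt2 (n p : ℕ) (hn : 2 ≤ n)
    (hpd : p ∣ n) (hplt : p < n) (hpmax : ∀ d : ℕ, d ∣ n → d < n → d ≤ p) :
    IsLeast {k : ℕ | ∃ S : Set (ISemi n),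
      IsSubsemigroup S ∧ (∀ φ ∈ S, IsSingular φ) ∧ Semitransitive S ∧ S.ncard = k}
      (2 * n - p + 1) := by
  have lower : ∀ S : Set (ISemi n), IsSubsemigroup S → (∀ φ ∈ S, IsSingular φ) →
      Semitransitive S → 2 * n - p + 1 ≤ S.ncard := by
    intro S hS hsing hst
    have := ISemi.le_ncard_of_semitransitive (by omega) hpmax hS hsing hst
    omega
  constructor
  · obtain ⟨S, hS, hsing, hst, hle⟩ := ISemi.exists_small_semitransitive hn hpd hplt
    exact ⟨S, hS, hsing, hst, hle.antisymm (lower S hS hsing hst)⟩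
  · rintro _ ⟨S, hS, hsing, hst, rfl⟩
    exact lower S hS hsing hst
end
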